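/- arXiv:1012.4531 — 3 statements merged into one kernel-verified Lean document; each statement's English description precedes it below -/
import Mathlib

section
/- Let k be a field, R = k[[x,y]]/(x³−y²), K = k(t), and A = R ⊗_k K. Let Φ be the 2×2 matrix over A given by Φ = [[y−xt, x−t²], [x², y+xt]], and let P be the cokernel of the A-linear map A² → A² defined by Φ. Then P is a finitely generated projective A-module such that P_𝔓 ≅ A_𝔓 for every prime ideal 𝔓 of A (so P is projective of rank one), and P is not a free A-module. -/
open TensorProduct

noncomputable section

set_option maxHeartbeats 1000000
set_option synthInstance.maxHeartbeats 400000

/-- The power series ring `k[[x,y]]`. -/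
abbrev PS (k : Type) [Field k] : Type := MvPowerSeries (Fin 2) k

/-- The hypersurface `R = k[[x,y]]/(x³ - y²)`. -/
abbrev Rcusp (k : Type) [Field k] : Type :=
  PS k ⧸ Ideal.span {(MvPowerSeries.X 0 : PS k) ^ 3 - (MvPowerSeries.X 1 : PS k) ^ 2}

/-- `A = R ⊗_k K` where `K = k(t)`. -/
def Acusp (k : Type) [Field k] : Type := Rcusp k ⊗[k] RatFunc k

instance (k : Type) [Field k] : CommRing (Acusp k) :=
  inferInstanceAs (CommRing (Rcusp k ⊗[k] RatFunc k))

instance (k : Type) [Field k] : Algebra k (Acusp k) :=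
  inferInstanceAs (Algebra k (Rcusp k ⊗[k] RatFunc k))

/-- The image of `x` in `A`. -/
def xA (k : Type) [Field k] : Acusp k :=
  (Ideal.Quotient.mk _ (MvPowerSeries.X 0 : PS k)) ⊗ₜ[k] (1 : RatFunc k)

/-- The image of `y` in `A`. -/
def yA (k : Type) [Field k] : Acusp k :=
  (Ideal.Quotient.mk _ (MvPowerSeries.X 1 : PS k)) ⊗ₜ[k] (1 : RatFunc k)

/-- The element `t ∈ A = R ⊗_k k(t)`. -/
def tA (k : Type) [Field k] : Acusp k := (1 : Rcusp k) ⊗ₜ[k] (RatFunc.X : RatFunc k)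

/-- The matrix `Φ = [[y - xt, x - t²], [x², y + xt]]` over `A`. -/
def Phi (k : Type) [Field k] : Matrix (Fin 2) (Fin 2) (Acusp k) :=
  !![yA k - xA k * tA k, xA k - tA k ^ 2; xA k ^ 2, yA k + xA k * tA k]

/-- `P = coker (Φ : A² → A²)`. -/
abbrev Pmod (k : Type) [Field k] : Type :=
  (Fin 2 → Acusp k) ⧸ LinearMap.range (Matrix.toLin' (Phi k))

/-- The elements of `k⟦X⟧` integral over `k` are the constants. -/
theorem powerSeries_eq_C_of_isIntegral {k : Type*} [Field k] {f : PowerSeries k}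
    (hf : IsIntegral k f) : f = PowerSeries.C (PowerSeries.constantCoeff f) := by
  set g := f - PowerSeries.C (PowerSeries.constantCoeff f) with hg
  have hint : IsIntegral k g := hf.sub (isIntegral_algebraMap (R := k))
  by_contra hne
  have hunit : IsUnit g := hint.isUnit (sub_ne_zero.mpr hne)
  have := hunit.map (PowerSeries.constantCoeff (R := k))
  simp [hg] at this

open Polynomial in
/-- A divisor in `k⟦s⟧[t]` of a nonzero element of `k[t]` is the product of a unit of `k⟦s⟧` and
a nonzero element of `k[t]`. -/
theorem exists_eq_unit_mul_map_of_dvd_map {k : Type*} [Field k] {w : (PowerSeries k)[X]} {p : k[X]}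
    (hp : p ≠ 0) (h : w ∣ p.map (PowerSeries.C (R := k))) :
    ∃ (u : PowerSeries k) (q : k[X]), IsUnit u ∧ q ≠ 0 ∧ w = C u * q.map PowerSeries.C := by
  have hlc : IsUnit w.leadingCoeff := by
    have h1 := leadingCoeff_dvd_leadingCoeff h
    rw [leadingCoeff_map_of_injective PowerSeries.C_injective] at h1
    exact isUnit_of_dvd_unit h1 ((leadingCoeff_ne_zero.mpr hp).isUnit.map _)
  obtain ⟨u, hu⟩ := hlc
  set w₀ := C (↑u⁻¹ : PowerSeries k) * w with hw₀
  have hw : w = C (u : PowerSeries k) * w₀ := by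
    rw [hw₀, ← mul_assoc, ← C_mul]; simp
  have hmonic : w₀.Monic := by
    rw [Monic, hw₀, leadingCoeff_mul, leadingCoeff_C, ← hu]; simp
  have hpm : (p * C p.leadingCoeff⁻¹).Monic := monic_mul_leadingCoeff_inv hp
  have hdvd : w₀ ∣ (p * C p.leadingCoeff⁻¹).map (algebraMap k (PowerSeries k)) := by
    rw [Polynomial.map_mul]
    exact ((Dvd.intro_left _ hw.symm).trans h).mul_right _
  have hint := isIntegral_coeff_of_dvd _ _ hpm hmonic hdvd
  obtain ⟨q, hq⟩ := (lifts_iff_coeff_lifts w₀ (f := PowerSeries.C (R := k))).mpr fun n =>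
    ⟨_, (powerSeries_eq_C_of_isIntegral (hint n)).symm⟩
  have hq' : q.map PowerSeries.C = w₀ := hq
  refine ⟨u, q, u.isUnit, ?_, by rw [hq', ← hw]⟩
  rintro rfl
  exact hmonic.ne_zero (by simpa using hq'.symm)

open Polynomial in
/-- Over the subring of `k⟦s⟧[t]` of polynomials whose coefficients have no linear term in `s`,
the row killing `(s - t, s²)` is not unimodular after inverting `k[t] ∖ {0}`. -/
theorem not_unimodular_of_coeff_one_eq_zero {k : Type*} [Field k] {a b c d : (PowerSeries k)[X]}
    (hb : ∀ n, PowerSeries.coeff 1 (b.coeff n) = 0) {p : k[X]} (hp : p ≠ 0)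
    (hab : a * (X - C PowerSeries.X) = b * C PowerSeries.X ^ 2)
    (h : a * c + b * d = p.map PowerSeries.C) : False := by
  have hroot : b.IsRoot (PowerSeries.X : PowerSeries k) := by
    have := congr_arg (eval (PowerSeries.X : PowerSeries k)) hab
    simpa [PowerSeries.X_ne_zero] using this
  obtain ⟨w, rfl⟩ := dvd_iff_isRoot.mpr hroot
  have ha : a = w * C PowerSeries.X ^ 2 := by
    apply mul_right_cancel₀ (X_sub_C_ne_zero (PowerSeries.X : PowerSeries k))
    rw [hab]; ring
  have hdvd : w ∣ p.map (PowerSeries.C (R := k)) :=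
    ⟨C PowerSeries.X ^ 2 * c + (X - C PowerSeries.X) * d, by rw [← h, ha]; ring⟩
  obtain ⟨u, q, hu, hq, rfl⟩ := exists_eq_unit_mul_map_of_dvd_map hp hdvd
  have hu0 : PowerSeries.coeff 0 u ≠ 0 := by
    simpa using (hu.map (PowerSeries.constantCoeff (R := k))).ne_zero
  have key : q * (X * C (PowerSeries.coeff 1 u) - C (PowerSeries.coeff 0 u)) = 0 := by
    ext n
    have h2 : (X - C PowerSeries.X) * (C u * q.map PowerSeries.C) =
        X * (C u * q.map PowerSeries.C) - C (PowerSeries.X * u) * q.map PowerSeries.C := by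
      rw [C_mul]; ring
    have h1 := hb n
    rw [h2, coeff_sub, coeff_C_mul, coeff_map] at h1
    have h3 : q * (X * C (PowerSeries.coeff 1 u) - C (PowerSeries.coeff 0 u)) =
        X * (q * C (PowerSeries.coeff 1 u)) - q * C (PowerSeries.coeff 0 u) := by ring
    rw [h3]
    cases n with
    | zero => simpa [mul_comm, PowerSeries.coeff_succ_X_mul] using h1
    | succ n =>
      rw [coeff_X_mul, coeff_C_mul, coeff_map, map_sub, PowerSeries.coeff_mul_C,
        PowerSeries.coeff_mul_C, show (1 : ℕ) = 0 + 1 from rfl, PowerSeries.coeff_succ_X_mul] at h1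
      simpa [mul_comm] using h1
  rcases mul_eq_zero.mp key with h0 | h0
  · exact hq h0
  · exact hu0 (by simpa using congr_arg (coeff · 0) h0)

section Localization

variable {R M : Type*} [CommRing R] [AddCommGroup M] [Module R M]

/-- If `f : M → R` and `g : R → M` compose both ways to multiplication by an element outside a
prime `𝔓`, then `M` localizes to `R_𝔓` at `𝔓`. -/
theorem nonempty_localizedModule_equiv_of_comp_eq_smul {𝔓 : Ideal R} [𝔓.IsPrime]
    (f : M →ₗ[R] R) (g : R →ₗ[R] M) {c : R} (hc : c ∉ 𝔓) (hfg : ∀ r, f (g r) = c * r)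
    (hgf : ∀ m, g (f m) = c • m) :
    Nonempty (LocalizedModule 𝔓.primeCompl M
      ≃ₗ[Localization.AtPrime 𝔓] Localization.AtPrime 𝔓) := by
  let h : M →ₗ[R] Localization.AtPrime 𝔓 := Algebra.linearMap R (Localization.AtPrime 𝔓) ∘ₗ f
  let c' : 𝔓.primeCompl := ⟨c, hc⟩
  have : IsLocalizedModule 𝔓.primeCompl h :=
    { map_units := IsLocalizedModule.map_units (Algebra.linearMap R (Localization.AtPrime 𝔓))
      surj := fun y => by
        obtain ⟨⟨a, s⟩, hs⟩ := IsLocalizedModule.surj 𝔓.primeCompl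
          (Algebra.linearMap R (Localization.AtPrime 𝔓)) y
        refine ⟨⟨g a, c' * s⟩, ?_⟩
        change (c' * s) • y = algebraMap R _ (f (g a))
        rw [hfg, mul_smul, hs, map_mul]
        exact Algebra.smul_def c (algebraMap R _ a)
      exists_of_eq := fun {x₁ x₂} hx => by
        obtain ⟨s, hs⟩ := IsLocalizedModule.exists_of_eq (S := 𝔓.primeCompl)
          (f := Algebra.linearMap R (Localization.AtPrime 𝔓)) hx
        refine ⟨s * c', ?_⟩
        have := congr_arg g hs
        simp only [Submonoid.smul_def, map_smul, hgf] at this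
        simpa [Submonoid.smul_def, mul_smul] using this }
  exact ⟨(IsLocalizedModule.iso 𝔓.primeCompl h).extendScalarsOfIsLocalization 𝔓.primeCompl _⟩

end Localization

section Cokernel

open Matrix

variable {R : Type*} [CommRing R] (N : Matrix (Fin 2) (Fin 2) R)

/-- The functional on the cokernel of a singular `2 × 2` matrix `N` induced by a row vector
`v` with `v N = 0`. -/
def cokernelFunctional (v : Fin 2 → R) (hv : v ᵥ* N = 0) :
    ((Fin 2 → R) ⧸ LinearMap.range (toLin' N)) →ₗ[R] R :=
  Submodule.liftQ _ (dotProductBilin R R v) <| by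
    rintro _ ⟨w, rfl⟩
    change v ⬝ᵥ N *ᵥ w = 0
    rw [dotProduct_mulVec, hv, zero_dotProduct]

theorem cokernelFunctional_mk (v : Fin 2 → R) (hv : v ᵥ* N = 0) (w : Fin 2 → R) :
    cokernelFunctional N v hv (Submodule.Quotient.mk w) = v ⬝ᵥ w := rfl

/-- The class of a vector in the cokernel of `N`, as a map from the base ring. -/
def cokernelVector (w : Fin 2 → R) : R →ₗ[R] ((Fin 2 → R) ⧸ LinearMap.range (toLin' N)) :=
  LinearMap.toSpanSingleton R _ (Submodule.Quotient.mk w)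

/-- For a singular `2 × 2` matrix `N` there are maps between `R` and the cokernel of `N` composing
both ways to multiplication by the lower off-diagonal entry. -/
theorem exists_comp_eq_smul_lower (hN : N.det = 0) :
    ∃ (f : ((Fin 2 → R) ⧸ LinearMap.range (toLin' N)) →ₗ[R] R)
      (g : R →ₗ[R] ((Fin 2 → R) ⧸ LinearMap.range (toLin' N))),
      (∀ r, f (g r) = N 1 0 * r) ∧ ∀ m, g (f m) = N 1 0 • m := by
  rw [det_fin_two] at hN
  refine ⟨cokernelFunctional N ![N 1 0, -N 0 0] ?_, cokernelVector N ![1, 0], ?_, ?_⟩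
  · ext i
    fin_cases i <;> simp [vecMul, dotProduct, Fin.sum_univ_two]
    · ring
    · linear_combination -hN
  · intro r
    simp [cokernelVector, cokernelFunctional_mk, mul_comm]
  · intro m
    induction m using Submodule.Quotient.induction_on with | _ w
    rw [cokernelFunctional_mk, cokernelVector, LinearMap.toSpanSingleton_apply,
      ← Submodule.Quotient.mk_smul, ← Submodule.Quotient.mk_smul, Submodule.Quotient.eq]
    refine ⟨![-w 1, 0], ?_⟩
    ext i
    fin_cases i <;> simp [mulVec, dotProduct, Fin.sum_univ_two]

/-- The analogue of `exists_comp_eq_smul_lower` for the upper off-diagonal entry. -/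
theorem exists_comp_eq_smul_upper (hN : N.det = 0) :
    ∃ (f : ((Fin 2 → R) ⧸ LinearMap.range (toLin' N)) →ₗ[R] R)
      (g : R →ₗ[R] ((Fin 2 → R) ⧸ LinearMap.range (toLin' N))),
      (∀ r, f (g r) = N 0 1 * r) ∧ ∀ m, g (f m) = N 0 1 • m := by
  rw [det_fin_two] at hN
  refine ⟨cokernelFunctional N ![-N 1 1, N 0 1] ?_, cokernelVector N ![0, 1], ?_, ?_⟩
  · ext i
    fin_cases i <;> simp [vecMul, dotProduct, Fin.sum_univ_two]
    · linear_combination -hN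
    · ring
  · intro r
    simp [cokernelVector, cokernelFunctional_mk, mul_comm]
  · intro m
    induction m using Submodule.Quotient.induction_on with | _ w
    rw [cokernelFunctional_mk, cokernelVector, LinearMap.toSpanSingleton_apply,
      ← Submodule.Quotient.mk_smul, ← Submodule.Quotient.mk_smul, Submodule.Quotient.eq]
    refine ⟨![0, -w 0], ?_⟩
    ext i
    fin_cases i <;> simp [mulVec, dotProduct, Fin.sum_univ_two]

variable {N}

theorem projective_cokernel_of_isCoprime (hN : N.det = 0) (h : IsCoprime (N 1 0) (N 0 1)) :
    Module.Projective R ((Fin 2 → R) ⧸ LinearMap.range (toLin' N)) := by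
  obtain ⟨f₁, g₁, -, h₁⟩ := exists_comp_eq_smul_lower N hN
  obtain ⟨f₂, g₂, -, h₂⟩ := exists_comp_eq_smul_upper N hN
  obtain ⟨α, β, hαβ⟩ := h
  refine Module.Projective.of_split (M := R × R) (f₁.prod f₂)
    ((α • g₁).coprod (β • g₂)) (LinearMap.ext fun m => ?_)
  change α • g₁ (f₁ m) + β • g₂ (f₂ m) = m
  rw [h₁, h₂, smul_smul, smul_smul, ← add_smul, hαβ, one_smul]

theorem nonempty_localizedModule_cokernel_equiv (hN : N.det = 0)
    (h : IsCoprime (N 1 0) (N 0 1)) (𝔓 : Ideal R) [h𝔓 : 𝔓.IsPrime] :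
    Nonempty (LocalizedModule 𝔓.primeCompl ((Fin 2 → R) ⧸ LinearMap.range (toLin' N))
      ≃ₗ[Localization.AtPrime 𝔓] Localization.AtPrime 𝔓) := by
  by_cases hc : N 1 0 ∈ 𝔓
  · obtain ⟨f, g, hfg, hgf⟩ := exists_comp_eq_smul_upper N hN
    refine nonempty_localizedModule_equiv_of_comp_eq_smul f g (fun hc' => ?_) hfg hgf
    obtain ⟨α, β, hαβ⟩ := h
    exact h𝔓.ne_top ((Ideal.eq_top_iff_one _).mpr
      (hαβ ▸ 𝔓.add_mem (𝔓.mul_mem_left α hc) (𝔓.mul_mem_left β hc')))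
  · obtain ⟨f, g, hfg, hgf⟩ := exists_comp_eq_smul_lower N hN
    exact nonempty_localizedModule_equiv_of_comp_eq_smul f g hc hfg hgf

/-- A nontrivial free cokernel of a `2 × 2` matrix yields a unimodular row killing the matrix. -/
theorem exists_unimodular_row_of_free
    [Nontrivial ((Fin 2 → R) ⧸ LinearMap.range (toLin' N))]
    [Module.Free R ((Fin 2 → R) ⧸ LinearMap.range (toLin' N))] :
    ∃ a b c d : R, a * c + b * d = 1 ∧ a * N 0 0 + b * N 1 0 = 0 ∧
      a * N 0 1 + b * N 1 1 = 0 := by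
  let B := Module.Free.chooseBasis R ((Fin 2 → R) ⧸ LinearMap.range (toLin' N))
  obtain ⟨i⟩ := B.index_nonempty
  let φ : (Fin 2 → R) →ₗ[R] R := B.coord i ∘ₗ Submodule.mkQ _
  obtain ⟨w, hw⟩ := Submodule.mkQ_surjective _ (B i)
  have hφ : ∀ v, φ v = φ ![1, 0] * v 0 + φ ![0, 1] * v 1 := fun v => by
    have : v = v 0 • ![1, 0] + v 1 • ![0, 1] := by ext j; fin_cases j <;> simp
    conv_lhs => rw [this]
    simp only [map_add, map_smul, smul_eq_mul, mul_comm]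
  have hφN : ∀ v, φ (N *ᵥ v) = 0 := fun v => by
    have : (LinearMap.range (toLin' N)).mkQ (N *ᵥ v) = 0 :=
      (Submodule.Quotient.mk_eq_zero _).mpr ⟨v, rfl⟩
    rw [LinearMap.comp_apply, this, map_zero]
  refine ⟨φ ![1, 0], φ ![0, 1], w 0, w 1, ?_, ?_, ?_⟩
  · rw [← hφ]
    simp [φ, hw]
  · have := hφN ![1, 0]
    rw [hφ] at this
    simpa [mulVec, dotProduct, Fin.sum_univ_two] using this
  · have := hφN ![0, 1]
    rw [hφ] at this
    simpa [mulVec, dotProduct, Fin.sum_univ_two] using this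

end Cokernel

section Cusp

open Polynomial

variable (k : Type) [Field k]

theorem hasSubst_cusp : MvPowerSeries.HasSubst
    (![PowerSeries.X ^ 2, PowerSeries.X ^ 3] : Fin 2 → PowerSeries k) := by
  refine MvPowerSeries.hasSubst_of_constantCoeff_zero fun i => ?_
  change PowerSeries.constantCoeff _ = 0
  fin_cases i <;> simp

/-- The parametrization `x ↦ s²`, `y ↦ s³` of the cusp, as a map `R → k⟦s⟧`. -/
def cuspParam : Rcusp k →ₐ[k] PowerSeries k :=
  Ideal.Quotient.liftₐ _ (MvPowerSeries.substAlgHom (hasSubst_cusp k)) fun f hf => by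
    obtain ⟨g, rfl⟩ := Ideal.mem_span_singleton.mp hf
    rw [map_mul, map_sub, map_pow, map_pow, MvPowerSeries.substAlgHom_X,
      MvPowerSeries.substAlgHom_X]
    simp [← pow_mul]

theorem cuspParam_mk (f : PS k) : cuspParam k (Ideal.Quotient.mk _ f) =
    MvPowerSeries.subst ![PowerSeries.X ^ 2, PowerSeries.X ^ 3] f :=
  MvPowerSeries.substAlgHom_apply (hasSubst_cusp k) f

/-- The power series without linear term. -/
def noLinearTerm : Subalgebra k (PowerSeries k) where
  carrier := {f | PowerSeries.coeff 1 f = 0}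
  mul_mem' {f g} hf hg := by
    change PowerSeries.coeff 1 f = 0 at hf
    change PowerSeries.coeff 1 g = 0 at hg
    change PowerSeries.coeff 1 (f * g) = 0
    simp [PowerSeries.coeff_mul, Finset.Nat.antidiagonal_succ, hf, hg]
  add_mem' {f g} hf hg := by
    change PowerSeries.coeff 1 f = 0 at hf
    change PowerSeries.coeff 1 g = 0 at hg
    change PowerSeries.coeff 1 (f + g) = 0
    rw [map_add, hf, hg, add_zero]
  algebraMap_mem' r := by
    change PowerSeries.coeff 1 (PowerSeries.C r) = 0
    simp

theorem cuspParam_mem_noLinearTerm (r : Rcusp k) : cuspParam k r ∈ noLinearTerm k := by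
  obtain ⟨f, rfl⟩ := Ideal.Quotient.mk_surjective r
  change PowerSeries.coeff 1 _ = 0
  rw [cuspParam_mk, PowerSeries.coeff, MvPowerSeries.coeff_subst (hasSubst_cusp k)]
  refine finsum_eq_zero_of_forall_eq_zero fun d => ?_
  have h : (d.prod fun s e => (![PowerSeries.X ^ 2, PowerSeries.X ^ 3] : Fin 2 → PowerSeries k) s
      ^ e) = PowerSeries.X ^ (2 * d 0 + 3 * d 1) := by
    rw [Finsupp.prod_fintype _ _ (by simp), Fin.prod_univ_two, pow_add, pow_mul, pow_mul]
    simp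
  rw [h]
  change _ • PowerSeries.coeff 1 _ = 0
  rw [PowerSeries.coeff_X_pow, if_neg (by omega), smul_zero]

/-- The embedding of `k(t)` into the fraction field of `k⟦s⟧[t]`. -/
def ratFuncToFrac : RatFunc k →ₐ[k] FractionRing (PowerSeries k)[X] :=
  RatFunc.liftAlgHom
    ((Algebra.ofId (PowerSeries k)[X] _).restrictScalars k |>.comp
      (mapAlgHom (Algebra.ofId k (PowerSeries k))))
    (nonZeroDivisors_le_comap_nonZeroDivisors_of_injective _
      ((IsFractionRing.injective (PowerSeries k)[X] _).comp
        (map_injective _ PowerSeries.C_injective)))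

theorem ratFuncToFrac_algebraMap (p : k[X]) : ratFuncToFrac k (algebraMap _ _ p) =
    algebraMap (PowerSeries k)[X] _ (p.map PowerSeries.C) := by
  have := RatFunc.liftAlgHom_apply_div
    ((Algebra.ofId (PowerSeries k)[X] (FractionRing (PowerSeries k)[X])).restrictScalars k |>.comp
      (mapAlgHom (Algebra.ofId k (PowerSeries k))))
    (nonZeroDivisors_le_comap_nonZeroDivisors_of_injective _
      ((IsFractionRing.injective (PowerSeries k)[X] _).comp
        (map_injective _ PowerSeries.C_injective))) p 1
  rw [map_one, div_one, map_one, div_one] at this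
  exact this

/-- The map from `A = R ⊗ k(t)` to the fraction field of `k⟦s⟧[t]` given by `x ↦ s²`, `y ↦ s³`. -/
def cuspToFrac : Acusp k →ₐ[k] FractionRing (PowerSeries k)[X] :=
  Algebra.TensorProduct.productMap
    (((Algebra.ofId (PowerSeries k)[X] (FractionRing (PowerSeries k)[X])).restrictScalars k).comp
      ((Algebra.ofId (PowerSeries k) (PowerSeries k)[X]).restrictScalars k |>.comp (cuspParam k)))
    (ratFuncToFrac k)

theorem cuspToFrac_tmul (r : Rcusp k) (z : RatFunc k) :
    cuspToFrac k (r ⊗ₜ[k] z : Rcusp k ⊗[k] RatFunc k) =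
      algebraMap (PowerSeries k)[X] _ (C (cuspParam k r)) * ratFuncToFrac k z :=
  Algebra.TensorProduct.productMap_apply_tmul _ _ _ _

theorem cuspToFrac_xA :
    cuspToFrac k (xA k) = algebraMap (PowerSeries k)[X] _ (C PowerSeries.X ^ 2) := by
  rw [xA, cuspToFrac_tmul, cuspParam_mk, MvPowerSeries.subst_X (hasSubst_cusp k)]
  simp

theorem cuspToFrac_yA :
    cuspToFrac k (yA k) = algebraMap (PowerSeries k)[X] _ (C PowerSeries.X ^ 3) := by
  rw [yA, cuspToFrac_tmul, cuspParam_mk, MvPowerSeries.subst_X (hasSubst_cusp k)]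
  simp

theorem cuspToFrac_tA : cuspToFrac k (tA k) = algebraMap (PowerSeries k)[X] _ X := by
  rw [tA, cuspToFrac_tmul, ← RatFunc.algebraMap_X, ratFuncToFrac_algebraMap]
  simp

theorem map_C_mem_lifts (p : k[X]) :
    p.map PowerSeries.C ∈ lifts (noLinearTerm k).val.toRingHom :=
  (lifts_iff_coeff_lifts _).mpr fun n =>
    ⟨algebraMap k _ (p.coeff n), by rw [coeff_map]; rfl⟩

theorem exists_denominator (a : Acusp k) :
    ∃ p : k[X], p ≠ 0 ∧ ∃ q ∈ lifts (noLinearTerm k).val.toRingHom,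
      cuspToFrac k a * algebraMap (PowerSeries k)[X] _ (p.map PowerSeries.C) =
        algebraMap (PowerSeries k)[X] _ q := by
  induction a using TensorProduct.induction_on with
  | zero => exact ⟨1, one_ne_zero, 0, zero_mem _,
      (congr_arg (· * _) (map_zero (cuspToFrac k))).trans (by simp)⟩
  | tmul r z =>
    refine ⟨z.denom, z.denom_ne_zero, C (cuspParam k r) * z.num.map PowerSeries.C,
      mul_mem ?_ (map_C_mem_lifts k _), ?_⟩
    · exact C_mem_lifts (noLinearTerm k).val.toRingHom ⟨_, cuspParam_mem_noLinearTerm k r⟩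
    · rw [cuspToFrac_tmul, map_mul, mul_assoc, ← ratFuncToFrac_algebraMap,
        ← ratFuncToFrac_algebraMap, ← map_mul]
      congr 2
      exact ((div_eq_iff (RatFunc.algebraMap_ne_zero z.denom_ne_zero)).mp z.num_div_denom).symm
  | add a b ha hb =>
    obtain ⟨p, hp, q, hq, h⟩ := ha
    obtain ⟨p', hp', q', hq', h'⟩ := hb
    refine ⟨p * p', mul_ne_zero hp hp', q * p'.map PowerSeries.C + q' * p.map PowerSeries.C,
      add_mem (mul_mem hq (map_C_mem_lifts k _)) (mul_mem hq' (map_C_mem_lifts k _)), ?_⟩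
    have hadd : cuspToFrac k (a + b : Rcusp k ⊗[k] RatFunc k) = cuspToFrac k a + cuspToFrac k b :=
      map_add (cuspToFrac k) a b
    rw [hadd, Polynomial.map_mul, map_add, map_mul, map_mul, map_mul, ← h, ← h']
    ring

theorem xA_pow_three : xA k ^ 3 = yA k ^ 2 := by
  have h : (Ideal.Quotient.mk _ (MvPowerSeries.X 0 : PS k) : Rcusp k) ^ 3 =
      Ideal.Quotient.mk _ (MvPowerSeries.X 1 : PS k) ^ 2 := by
    rw [← map_pow, ← map_pow, Ideal.Quotient.mk_eq_mk_iff_sub_mem]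
    exact Ideal.mem_span_singleton_self _
  have h' := congr_arg (Algebra.TensorProduct.includeLeft : Rcusp k →ₐ[k] Rcusp k ⊗[k] RatFunc k) h
  rw [map_pow, map_pow] at h'
  exact h'

theorem isUnit_tA : IsUnit (tA k) :=
  (RatFunc.X_ne_zero (K := k)).isUnit.map
    (Algebra.TensorProduct.includeRight : RatFunc k →ₐ[k] Rcusp k ⊗[k] RatFunc k)

theorem det_Phi : (Phi k).det = 0 := by
  rw [Phi, Matrix.det_fin_two_of]
  linear_combination -xA_pow_three k

theorem isCoprime_Phi : IsCoprime (Phi k 1 0) (Phi k 0 1) := by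
  obtain ⟨v, hv⟩ := (isUnit_tA k).exists_left_inv
  refine ⟨v ^ 4, -(v ^ 4 * (xA k + tA k ^ 2)), ?_⟩
  simp only [Phi, Matrix.of_apply, Matrix.cons_val_zero, Matrix.cons_val_one]
  have : v ^ 4 * tA k ^ 4 = 1 := by rw [← mul_pow, hv, one_pow]
  linear_combination this

theorem not_exists_unimodular_row {a b c d : Acusp k} (h : a * c + b * d = 1)
    (h₀ : a * (yA k - xA k * tA k) + b * xA k ^ 2 = 0) : False := by
  obtain ⟨p₁, hp₁, a', -, ha⟩ := exists_denominator k a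
  obtain ⟨p₂, hp₂, b', hb', hb⟩ := exists_denominator k b
  obtain ⟨p₃, hp₃, c', -, hc⟩ := exists_denominator k c
  obtain ⟨p₄, hp₄, d', -, hd⟩ := exists_denominator k d
  have hinj := IsFractionRing.injective (PowerSeries k)[X] (FractionRing (PowerSeries k)[X])
  have hF := congr_arg (cuspToFrac k) h
  have hF₀ := congr_arg (cuspToFrac k) h₀
  simp only [map_add, map_mul, map_sub, map_pow, map_one, map_zero, cuspToFrac_xA, cuspToFrac_yA,
    cuspToFrac_tA] at hF hF₀
  have hs : algebraMap (PowerSeries k)[X] (FractionRing (PowerSeries k)[X]) (C PowerSeries.X) ≠ 0 :=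
    (map_ne_zero_iff _ hinj).mpr (C_ne_zero.mpr PowerSeries.X_ne_zero)
  refine not_unimodular_of_coeff_one_eq_zero (a := a' * p₂.map PowerSeries.C)
    (b := b' * p₁.map PowerSeries.C)
    (c := c' * p₄.map PowerSeries.C) (d := d' * p₃.map PowerSeries.C)
    (p := p₁ * p₂ * p₃ * p₄) (fun n => ?_)
    (mul_ne_zero (mul_ne_zero (mul_ne_zero hp₁ hp₂) hp₃) hp₄) (hinj ?_) (hinj ?_)
  · obtain ⟨f, hf⟩ := (lifts_iff_coeff_lifts _).mp (mul_mem hb' (map_C_mem_lifts k p₁)) n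
    rw [← hf]
    exact f.2
  · simp only [map_mul, map_sub, map_pow, ← ha, ← hb]
    refine mul_left_cancel₀ (pow_ne_zero 2 hs) ?_
    linear_combination (-algebraMap (PowerSeries k)[X] (FractionRing (PowerSeries k)[X])
      (p₁.map PowerSeries.C) * algebraMap (PowerSeries k)[X] (FractionRing (PowerSeries k)[X])
      (p₂.map PowerSeries.C)) * hF₀
  · simp only [map_mul, map_add, Polynomial.map_mul, ← ha, ← hb, ← hc, ← hd]
    linear_combination (algebraMap (PowerSeries k)[X] (FractionRing (PowerSeries k)[X])
      (p₁.map PowerSeries.C) * algebraMap (PowerSeries k)[X] (FractionRing (PowerSeries k)[X])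
      (p₂.map PowerSeries.C) * algebraMap (PowerSeries k)[X] (FractionRing (PowerSeries k)[X])
      (p₃.map PowerSeries.C) * algebraMap (PowerSeries k)[X] (FractionRing (PowerSeries k)[X])
      (p₄.map PowerSeries.C)) * hF

end Cusp

/-- **Yoshino, Example 3.1.**  Let `R = k[[x,y]]/(x³-y²)`, `K = k(t)`, `A = R ⊗_k K`, and
let `P` be the cokernel of the map `A² → A²` given by the matrix
`Φ = [[y - xt, x - t²], [x², y + xt]]`.  Then `P` is a finitely generated projective
`A`-module with `P_𝔓 ≅ A_𝔓` for every prime ideal `𝔓` of `A` (so `P` is projective of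
rank one), but `P` is not a free `A`-module. -/
theorem cokernel_projective_rank_one_not_free (k : Type) [Field k] :
    Module.Finite (Acusp k) (Pmod k) ∧
    Module.Projective (Acusp k) (Pmod k) ∧
    (∀ (𝔓 : Ideal (Acusp k)) (_ : 𝔓.IsPrime),
      Nonempty ((LocalizedModule 𝔓.primeCompl (Pmod k))
        ≃ₗ[Localization.AtPrime 𝔓] (Localization.AtPrime 𝔓))) ∧
    ¬ Module.Free (Acusp k) (Pmod k) := by
  have hloc := nonempty_localizedModule_cokernel_equiv (det_Phi k) (isCoprime_Phi k)
  refine ⟨inferInstance, projective_cokernel_of_isCoprime (det_Phi k) (isCoprime_Phi k),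
    fun 𝔓 _ => hloc 𝔓, fun hfree => ?_⟩
  have : Nontrivial (Acusp k) := (cuspToFrac k).toRingHom.domain_nontrivial
  have : Nontrivial (Pmod k) := by
    obtain ⟨𝔓, h𝔓⟩ := Ideal.exists_maximal (Acusp k)
    obtain ⟨e⟩ := hloc 𝔓
    by_contra hP
    rw [not_nontrivial_iff_subsingleton] at hP
    exact not_subsingleton (Localization.AtPrime 𝔓) e.symm.injective.subsingleton
  obtain ⟨a, b, c, d, h, h₀, -⟩ := exists_unimodular_row_of_free (N := Phi k)
  exact not_exists_unimodular_row k h h₀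

end
end

section
/- Let k be an infinite field, (R, 𝔪, k) a commutative noetherian local k-algebra, V = k[t]_(t) and K = k(t). Suppose a finitely generated R⊗_k V-module P′ satisfies: (1) P′ is a submodule of a finitely generated free R⊗_k V-module, and (2) the localization P = P′_t is a projective R⊗_k K-module. Then there exist a finitely generated R-module X and a non-negative integer n together with a short exact sequence of R⊗_k V-modules 0 → X⊗_k V → (X⊗_k V) ⊕ (R^n⊗_k V) → P′ → 0. -/
open TensorProduct

noncomputable section

set_option maxHeartbeats 1000000
set_option synthInstance.maxHeartbeats 400000

instance spanXIsPrime (k : Type) [Field k] :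
    (Ideal.span {(Polynomial.X : Polynomial k)}).IsPrime :=
  (Ideal.span_singleton_prime Polynomial.X_ne_zero).mpr Polynomial.prime_X

section Helpers

open Polynomial

section DegreeFiltration

/-- A filtration of an `R[X]`-module by `R`-submodules which behaves like the filtration of a
submodule of a free module by degree. -/
structure IsDegreeFiltration {R L : Type*} [CommRing R] [AddCommGroup L] [Module R L]
    [Module R[X] L] (G : ℕ → Submodule R L) : Prop where
  mono : Monotone G
  zero : G 0 = ⊥
  exists_mem : ∀ v, ∃ n, v ∈ G n
  X_smul_mem_iff : ∀ {n v}, (X : R[X]) • v ∈ G (n + 1) ↔ v ∈ G n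

variable {R : Type*} [CommRing R]

/-- The coefficient of `X ^ j` of an element of `R[X] ⊗[R] M`. -/
def tensorCoeff (M : Type*) [AddCommGroup M] [Module R M] (j : ℕ) : R[X] ⊗[R] M →ₗ[R] M :=
  TensorProduct.lid R M ∘ₗ (lcoeff R j).rTensor M

section tensorCoeff

variable {M N : Type*} [AddCommGroup M] [Module R M] [AddCommGroup N] [Module R N]

@[simp]
lemma tensorCoeff_tmul (j : ℕ) (p : R[X]) (m : M) :
    tensorCoeff M j (p ⊗ₜ m) = p.coeff j • m := by
  simp [tensorCoeff]

lemma tensorCoeff_X_smul_succ (j : ℕ) (z : R[X] ⊗[R] M) :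
    tensorCoeff M (j + 1) ((X : R[X]) • z) = tensorCoeff M j z := by
  induction z with
  | zero => simp
  | tmul p m => simp [TensorProduct.smul_tmul']
  | add x y hx hy => rw [smul_add, map_add, hx, hy, map_add]

lemma tensorCoeff_baseChange (j : ℕ) (f : M →ₗ[R] N) (z : R[X] ⊗[R] M) :
    tensorCoeff N j (f.baseChange R[X] z) = f (tensorCoeff M j z) := by
  induction z with
  | zero => simp
  | tmul p m => simp
  | add x y hx hy => simp only [map_add, hx, hy]

lemma exists_forall_tensorCoeff_eq_zero (z : R[X] ⊗[R] M) :
    ∃ N, ∀ j, N ≤ j → tensorCoeff M j z = 0 := by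
  induction z with
  | zero => exact ⟨0, by simp⟩
  | tmul p m =>
    refine ⟨p.natDegree + 1, fun j hj ↦ ?_⟩
    rw [tensorCoeff_tmul, coeff_eq_zero_of_natDegree_lt (by omega), zero_smul]
  | add x y hx hy =>
    obtain ⟨a, ha⟩ := hx
    obtain ⟨b, hb⟩ := hy
    exact ⟨max a b, fun j hj ↦ by
      rw [map_add, ha j (le_of_max_le_left hj), hb j (le_of_max_le_right hj), add_zero]⟩

lemma eq_sum_tensorCoeff (z : R[X] ⊗[R] M) (N : ℕ) (hN : ∀ j, N ≤ j → tensorCoeff M j z = 0) :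
    z = ∑ j ∈ Finset.range N, ((X : R[X]) ^ j) ⊗ₜ[R] tensorCoeff M j z := by
  have key : ∃ N₀, ∀ N, N₀ ≤ N →
      z = ∑ j ∈ Finset.range N, ((X : R[X]) ^ j) ⊗ₜ[R] tensorCoeff M j z := by
    clear hN
    induction z with
    | zero => exact ⟨0, by simp⟩
    | tmul p m =>
      refine ⟨p.natDegree + 1, fun N hN ↦ ?_⟩
      conv_lhs => rw [p.as_sum_range' N (by omega), TensorProduct.sum_tmul]
      refine Finset.sum_congr rfl fun j _ ↦ ?_
      rw [tensorCoeff_tmul, ← TensorProduct.smul_tmul, smul_X_eq_monomial]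
    | add x y hx hy =>
      obtain ⟨a, ha⟩ := hx
      obtain ⟨b, hb⟩ := hy
      refine ⟨max a b, fun N hN ↦ ?_⟩
      simp only [map_add, TensorProduct.tmul_add, Finset.sum_add_distrib]
      rw [← ha N (le_of_max_le_left hN), ← hb N (le_of_max_le_right hN)]
  obtain ⟨N₀, h₀⟩ := key
  conv_lhs => rw [h₀ (max N₀ N) (le_max_left _ _)]
  refine (Finset.sum_subset (by simp) fun j _ hj ↦ ?_).symm
  rw [hN j (by simpa using hj), TensorProduct.tmul_zero]

end tensorCoeff

variable {L : Type*} [AddCommGroup L] [Module R L] [Module R[X] L]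

namespace IsDegreeFiltration

variable {G : ℕ → Submodule R L}

lemma X_pow_smul_mem_iff (hG : IsDegreeFiltration G) {n : ℕ} {v : L} (j : ℕ) :
    (X : R[X]) ^ j • v ∈ G (n + j) ↔ v ∈ G n := by
  induction j with
  | zero => simp
  | succ j ih => rw [pow_succ', mul_smul, ← add_assoc, hG.X_smul_mem_iff, ih]

variable [IsScalarTower R R[X] L]

/-- Multiplication by `X` as a map from a step of the filtration to the next one. -/
def mulX (hG : IsDegreeFiltration G) (n : ℕ) : G n →ₗ[R] G (n + 1) :=
  (Algebra.lsmul R R L (X : R[X])).restrict fun _ hv ↦ hG.X_smul_mem_iff.mpr hv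

/-- The map `x ↦ X ⊗ x - 1 ⊗ (X • x)`. -/
def swanMap (hG : IsDegreeFiltration G) (n : ℕ) : R[X] ⊗[R] G n →ₗ[R[X]] R[X] ⊗[R] G (n + 1) :=
  (X : R[X]) • (Submodule.inclusion (hG.mono n.le_succ)).baseChange R[X] -
    (hG.mulX n).baseChange R[X]

lemma swanMap_tmul (hG : IsDegreeFiltration G) (n : ℕ) (p : R[X]) (x : G n) :
    hG.swanMap n (p ⊗ₜ x) =
      (X * p) ⊗ₜ Submodule.inclusion (hG.mono n.le_succ) x - p ⊗ₜ hG.mulX n x := by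
  simp [swanMap, TensorProduct.smul_tmul']

lemma swanMap_injective (hG : IsDegreeFiltration G) (n : ℕ) : Function.Injective (hG.swanMap n) := by
  rw [← LinearMap.ker_eq_bot, LinearMap.ker_eq_bot']
  intro z hz
  obtain ⟨N, hN⟩ := exists_forall_tensorCoeff_eq_zero z
  have step (j : ℕ) (hj : tensorCoeff _ (j + 1) z = 0) : tensorCoeff _ j z = 0 := by
    have h := congrArg (tensorCoeff _ (j + 1)) hz
    rw [swanMap, LinearMap.sub_apply, LinearMap.smul_apply, map_sub, tensorCoeff_X_smul_succ,
      tensorCoeff_baseChange, tensorCoeff_baseChange, hj, map_zero, sub_zero, map_zero] at h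
    exact Submodule.inclusion_injective _ (h.trans (map_zero _).symm)
  have all (i : ℕ) : ∀ j, N ≤ j + i → tensorCoeff _ j z = 0 := by
    induction i with
    | zero => exact hN
    | succ i ih => exact fun j hj ↦ step j (ih _ (by omega))
  rw [eq_sum_tensorCoeff z 0 fun j _ ↦ all N j (by omega), Finset.sum_range_zero]

lemma swanMap_exact (hG : IsDegreeFiltration G) (n : ℕ) :
    Function.Exact (hG.swanMap n) ((G (n + 1)).subtype.liftBaseChange R[X]) := by
  have hcomp (w) : (G (n + 1)).subtype.liftBaseChange R[X] (hG.swanMap n w) = 0 := by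
    induction w with
    | zero => simp
    | tmul p x =>
      rw [swanMap_tmul, map_sub, LinearMap.liftBaseChange_tmul, LinearMap.liftBaseChange_tmul]
      rw [mul_comm, mul_smul, sub_eq_zero]
      rfl
    | add x y hx hy => rw [map_add, map_add, hx, hy, add_zero]
  have key (N : ℕ) : ∀ z, (∀ j, N + 1 ≤ j → tensorCoeff _ j z = 0) →
      (G (n + 1)).subtype.liftBaseChange R[X] z = 0 → ∃ w, hG.swanMap n w = z := by
    induction N with
    | zero =>
      intro z hz hz0
      rw [eq_sum_tensorCoeff z 1 hz] at hz0
      have : tensorCoeff _ 0 z = 0 := by simpa using hz0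
      refine ⟨0, ?_⟩
      rw [eq_sum_tensorCoeff z 1 hz]
      simp [this]
    | succ N ih =>
      intro z hz hz0
      have hmem : (tensorCoeff (G (n + 1)) (N + 1) z : L) ∈ G n := by
        rw [← hG.X_pow_smul_mem_iff (N + 1)]
        have h := hz0
        rw [eq_sum_tensorCoeff z _ hz, Finset.sum_range_succ, map_add, map_sum,
          LinearMap.liftBaseChange_tmul, add_eq_zero_iff_eq_neg'] at h
        rw [Submodule.subtype_apply] at h
        rw [h]
        refine neg_mem (sum_mem fun j hj ↦ ?_)
        rw [LinearMap.liftBaseChange_tmul]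
        refine hG.mono (?_ : n + 1 + j ≤ _) ((hG.X_pow_smul_mem_iff j).mpr (Subtype.prop _))
        have := Finset.mem_range.mp hj
        omega
      obtain ⟨w, hw⟩ := ih (z - hG.swanMap n ((X ^ N) ⊗ₜ ⟨_, hmem⟩)) (fun j hj ↦ by
        rw [map_sub, swanMap_tmul, map_sub, tensorCoeff_tmul, tensorCoeff_tmul, ← pow_succ',
          coeff_X_pow, coeff_X_pow, if_neg (by omega : j ≠ N), zero_smul, sub_zero]
        split_ifs with h
        · subst h
          rw [one_smul, sub_eq_zero]
          rfl
        · rw [zero_smul, sub_zero, hz j (by omega)]) (by rw [map_sub, hz0, hcomp, sub_zero])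
      exact ⟨w + (X ^ N) ⊗ₜ ⟨_, hmem⟩, by rw [map_add, hw, sub_add_cancel]⟩
  intro z
  refine ⟨fun hz ↦ ?_, fun ⟨w, hw⟩ ↦ hw ▸ hcomp w⟩
  obtain ⟨N, hN⟩ := exists_forall_tensorCoeff_eq_zero z
  exact key N z (fun j hj ↦ hN j (by omega)) hz

lemma mem_of_X_sub_C_smul_mem (hG : IsDegreeFiltration G) {n : ℕ} {v : L} (a : R)
    (hv : (X - C a : R[X]) • v ∈ G (n + 1)) : v ∈ G n := by
  have step (i : ℕ) (hi : v ∈ G (n + i)) : v ∈ G n := by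
    induction i with
    | zero => exact hi
    | succ i ih =>
      refine ih (hG.X_smul_mem_iff.mp ?_)
      have h : (X : R[X]) • v = (X - C a : R[X]) • v + a • v := by
        rw [sub_smul, C_eq_algebraMap, algebraMap_smul, sub_add_cancel]
      rw [h]
      exact add_mem (hG.mono (by omega) hv) (Submodule.smul_mem _ _ hi)
  obtain ⟨N, hN⟩ := hG.exists_mem v
  exact step N (hG.mono (by omega) hN)

lemma X_sub_C_smul_injective (hG : IsDegreeFiltration G) (a : R) :
    Function.Injective fun v : L ↦ (X - C a : R[X]) • v := by
  intro v w h
  rw [← sub_eq_zero, ← Submodule.mem_bot R, ← hG.zero]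
  refine hG.mem_of_X_sub_C_smul_mem a ?_
  rw [smul_sub, sub_eq_zero.mpr h]
  exact zero_mem _


end IsDegreeFiltration

/-- The specialization of an `R[X]`-module at `X = a`, as an `R`-module. -/
abbrev Polynomial.Specialization (L : Type*) [AddCommGroup L] [Module R L]
    [Module R[X] L] [IsScalarTower R R[X] L] (a : R) : Type _ :=
  L ⧸ LinearMap.range (Algebra.lsmul R R L (X - C a : R[X]))

lemma Polynomial.mk_smul_specialization [IsScalarTower R R[X] L] (a : R) (p : R[X]) (v : L) :
    (Submodule.Quotient.mk (p • v) : Specialization L a) =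
      p.eval a • Submodule.Quotient.mk v := by
  rw [← Submodule.Quotient.mk_smul, Submodule.Quotient.eq]
  obtain ⟨q, hq⟩ := X_sub_C_dvd_sub_C_eval (a := a) (p := p)
  refine ⟨q • v, ?_⟩
  change (X - C a : R[X]) • q • v = _
  rw [smul_smul, ← hq, sub_smul, C_eq_algebraMap, algebraMap_smul]

namespace IsDegreeFiltration

variable {G : ℕ → Submodule R L} [IsScalarTower R R[X] L]

lemma exists_equiv_prod (hG : IsDegreeFiltration G) [IsLocalRing R] {n : ℕ}
    (hspan : Submodule.span R[X] (G (n + 1) : Set L) = ⊤) [Module.Finite R (G (n + 1))] (a : R)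
    [Module.Projective R (Specialization L a)] :
    ∃ m : ℕ, Nonempty ((G n × (Fin m → R)) ≃ₗ[R] G (n + 1)) := by
  let g : G (n + 1) →ₗ[R] Specialization L a := Submodule.mkQ _ ∘ₗ (G (n + 1)).subtype
  have hg : Function.Surjective g := by
    intro q
    obtain ⟨v, rfl⟩ := Submodule.Quotient.mk_surjective _ q
    have hv : v ∈ Submodule.span R[X] (G (n + 1) : Set L) := hspan ▸ Submodule.mem_top
    induction hv using Submodule.span_induction with
    | mem x hx => exact ⟨⟨x, hx⟩, rfl⟩
    | zero => exact ⟨0, map_zero g⟩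
    | add x y _ _ hx hy =>
      obtain ⟨x', hx⟩ := hx
      obtain ⟨y', hy⟩ := hy
      exact ⟨x' + y', by rw [map_add, hx, hy, Submodule.Quotient.mk_add]⟩
    | smul p x _ hx =>
      obtain ⟨x', hx⟩ := hx
      exact ⟨p.eval a • x', by rw [map_smul, hx, mk_smul_specialization]⟩
  let j : G n →ₗ[R] G (n + 1) := hG.mulX n - a • Submodule.inclusion (hG.mono n.le_succ)
  have hj (x : G n) : (j x : L) = (X - C a : R[X]) • (x : L) := by
    rw [sub_smul, C_eq_algebraMap, algebraMap_smul]
    rfl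
  have hj_inj : Function.Injective j := fun x y h ↦
    Subtype.ext (hG.X_sub_C_smul_injective a (by simp only [← hj, h]))
  have hex : LinearMap.range j = LinearMap.ker g := by
    ext y
    rw [LinearMap.mem_ker, LinearMap.comp_apply, Submodule.mkQ_apply,
      Submodule.Quotient.mk_eq_zero]
    constructor
    · rintro ⟨x, rfl⟩
      exact ⟨x, (hj x).symm⟩
    · rintro ⟨v, hv⟩
      have hv' : v ∈ G n := by
        refine hG.mem_of_X_sub_C_smul_mem a ?_
        exact (congrArg (· ∈ G (n + 1)) hv).mpr y.2
      exact ⟨⟨v, hv'⟩, Subtype.ext ((hj _).trans hv)⟩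
  obtain ⟨s, hs⟩ := Module.projective_lifting_property g LinearMap.id hg
  have : Module.Finite R (Specialization L a) := Module.Finite.of_surjective g hg
  have : Module.Free R (Specialization L a) := Module.free_of_flat_of_isLocalRing
  exact ⟨_, ⟨(LinearEquiv.refl R _).prodCongr (Module.finBasis R _).equivFun.symm ≪≫ₗ
    lequivProdOfRightSplitExact hj_inj hex hs⟩⟩

end IsDegreeFiltration

lemma Polynomial.projective_specialization [IsScalarTower R R[X] L] {m : ℕ}
    (π : (Fin m → R[X]) →ₗ[R[X]] L)
    (h : L →ₗ[R[X]] (Fin m → R[X])) (g : R[X]) (hπ : ∀ v, π (h v) = g • v) {a : R}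
    (ha : IsUnit (g.eval a)) : Module.Projective R (Specialization L a) := by
  let ev : (Fin m → R[X]) →ₗ[R] (Fin m → R) := (Polynomial.aeval a).toLinearMap.compLeft _
  let cst : (Fin m → R) →ₗ[R] (Fin m → R[X]) := (Algebra.linearMap R R[X]).compLeft _
  have mk_eq (v : Fin m → R[X]) : (Submodule.Quotient.mk (π v) : Specialization L a) =
      Submodule.Quotient.mk (π (cst (ev v))) := by
    rw [Submodule.Quotient.eq, ← map_sub]
    choose w hw using fun j ↦ X_sub_C_dvd_sub_C_eval (a := a) (p := v j)
    refine ⟨π w, ?_⟩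
    change (X - C a : R[X]) • π w = _
    rw [← map_smul]
    congr 1
    ext1 j
    simpa [ev, cst, coe_aeval_eq_eval] using (hw j).symm
  let i : Specialization L a →ₗ[R] (Fin m → R) :=
    Submodule.liftQ _ (ev ∘ₗ h.restrictScalars R) <| by
      rintro _ ⟨v, rfl⟩
      ext j
      simp [ev]
  let s : (Fin m → R) →ₗ[R] Specialization L a :=
    (ha.unit⁻¹ : Rˣ) • (Submodule.mkQ _ ∘ₗ π.restrictScalars R ∘ₗ cst)
  refine Module.Projective.of_split i s (LinearMap.ext fun q ↦ ?_)
  obtain ⟨v, rfl⟩ := Submodule.Quotient.mk_surjective _ q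
  change (ha.unit⁻¹ : Rˣ) • (Submodule.Quotient.mk (π (cst (ev (h v)))) : Specialization L a) =
    Submodule.Quotient.mk v
  rw [← mk_eq, hπ, mk_smul_specialization, inv_smul_eq_iff]
  rfl

end DegreeFiltration

section LocalizedSections

variable {A : Type*} [CommRing A]

lemma exists_comp_eq_smul_id_of_projective_localizedModule (S : Submonoid A) {F N : Type*}
    [AddCommGroup F] [Module A F] [AddCommGroup N] [Module A N] [Module.FinitePresentation A N]
    [Module.Projective (Localization S) (LocalizedModule S N)] (π : F →ₗ[A] N)
    (hπ : Function.Surjective π) :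
    ∃ (h : N →ₗ[A] F) (s : S), ∀ x, π (h x) = s • x := by
  obtain ⟨σ, hσ⟩ := Module.projective_lifting_property (LocalizedModule.map S π) LinearMap.id
    (LocalizedModule.map_surjective S π hπ)
  obtain ⟨h, s, hh⟩ := Module.FinitePresentation.exists_lift_of_isLocalizedModule S
    (LocalizedModule.mkLinearMap S F) (σ.restrictScalars A ∘ₗ LocalizedModule.mkLinearMap S N)
  obtain ⟨s', hs'⟩ := Module.Finite.exists_smul_of_comp_eq_of_isLocalizedModule S
    (LocalizedModule.mkLinearMap S N) (π ∘ₗ h) (s • LinearMap.id) <| by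
      ext x
      have h := congrArg (LocalizedModule.map S π) (LinearMap.congr_fun hh x)
      have hσx := LinearMap.congr_fun hσ (LocalizedModule.mkLinearMap S N x)
      simp only [LinearMap.comp_apply, LinearMap.smul_apply, LinearMap.map_smul_of_tower,
        LinearMap.restrictScalars_apply, LinearMap.id_apply, LocalizedModule.mkLinearMap_apply,
        LocalizedModule.map_mk] at h hσx ⊢
      rw [h, hσx]
  exact ⟨s' • h, s' * s, fun x ↦ by
    simpa [mul_smul] using LinearMap.congr_fun hs' x⟩

variable {B : Type*} [CommRing B] [Algebra A B] (M : Submonoid A) [IsLocalization M B]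
  {P : Type*} [AddCommGroup P] [Module A P] [Module B P] [IsScalarTower A B P]

/-- The localization map on a free module. -/
def piLocalization (A B : Type*) [CommRing A] [CommRing B] [Algebra A B] (r : ℕ) :
    (Fin r → A) →ₗ[A] (Fin r → B) :=
  .pi fun i ↦ Algebra.linearMap A B ∘ₗ .proj i

instance (r : ℕ) : IsLocalizedModule M (piLocalization A B r) :=
  inferInstanceAs (IsLocalizedModule M (.pi fun i ↦ Algebra.linearMap A B ∘ₗ .proj i))

lemma exists_submodule_isLocalizedModule {r : ℕ} (emb : P →ₗ[B] (Fin r → B))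
    (hemb : Function.Injective emb) :
    ∃ (L : Submodule A (Fin r → A)) (f : L →ₗ[A] P), IsLocalizedModule M f := by
  let embA := emb.restrictScalars A
  let L := (LinearMap.range embA).comap (piLocalization A B r)
  let e := LinearEquiv.ofInjective embA hemb
  let f : L →ₗ[A] P := e.symm ∘ₗ (piLocalization A B r).restrict
    (p := L) (q := LinearMap.range embA) fun _ hv ↦ hv
  have hf (v : L) : emb (f v) = piLocalization A B r v :=
    congrArg Subtype.val (e.apply_symm_apply _)
  refine ⟨L, f, ?_, fun y ↦ ?_, fun {x₁ x₂} h ↦ ?_⟩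
  · intro x
    refine (congrArg IsUnit (LinearMap.ext fun y ↦ ?_)).mp
      ((IsLocalization.map_units B x).map (Algebra.lsmul A A P))
    exact algebraMap_smul B (x : A) y
  · obtain ⟨⟨v, s⟩, hv⟩ := IsLocalizedModule.surj M (piLocalization A B r) (emb y)
    have h : embA (s • y) = piLocalization A B r v := by
      rw [← hv]
      exact map_smul embA _ _
    exact ⟨⟨⟨v, s • y, h⟩, s⟩, hemb (h.trans (hf ⟨v, s • y, h⟩).symm)⟩
  · have h' : piLocalization A B r x₁ = piLocalization A B r x₂ := by rw [← hf, ← hf, h]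
    obtain ⟨c, hc⟩ := IsLocalizedModule.exists_of_eq (S := M) h'
    exact ⟨c, Subtype.ext hc⟩

lemma exists_comp_eq_smul_id_of_isLocalizedModule {L : Type*} [AddCommGroup L] [Module A L]
    [Module.FinitePresentation A L] (f : L →ₗ[A] P) [IsLocalizedModule M f]
    [Module.FinitePresentation B P] (t : A)
    [Module.Projective (Localization (Submonoid.powers (algebraMap A B t)))
      (LocalizedModule (Submonoid.powers (algebraMap A B t)) P)] :
    ∃ (m : ℕ) (π : (Fin m → A) →ₗ[A] L) (h : L →ₗ[A] (Fin m → A)) (s : M) (j : ℕ),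
      ∀ v, π (h v) = ((s : A) * t ^ j) • v := by
  obtain ⟨m, l, hl⟩ := Module.Finite.exists_fin (R := A) (M := L)
  let π := Fintype.linearCombination A l
  let πB := Fintype.linearCombination B (f ∘ l)
  have hπB : Function.Surjective πB := by
    rw [← LinearMap.range_eq_top, Fintype.range_linearCombination, Set.range_comp]
    exact span_eq_top_of_isLocalizedModule B M f hl
  have hcomm (v) : πB (piLocalization A B m v) = f (π v) := by
    simp [πB, π, Fintype.linearCombination_apply, piLocalization]
  obtain ⟨h, s₀, hh⟩ := exists_comp_eq_smul_id_of_projective_localizedModule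
    (Submonoid.powers (algebraMap A B t)) πB hπB
  obtain ⟨j, hj⟩ := s₀.2
  obtain ⟨h', s, hs⟩ := Module.FinitePresentation.exists_lift_of_isLocalizedModule M
    (piLocalization A B m) (h.restrictScalars A ∘ₗ f)
  obtain ⟨s', hs'⟩ := Module.Finite.exists_smul_of_comp_eq_of_isLocalizedModule M f
    (π ∘ₗ h') (s • t ^ j • LinearMap.id) <| by
      ext v
      have h1 := congrArg πB (LinearMap.congr_fun hs v)
      rw [LinearMap.comp_apply, hcomm] at h1
      rw [LinearMap.comp_apply, LinearMap.comp_apply, h1, LinearMap.smul_apply,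
        LinearMap.map_smul_of_tower, LinearMap.comp_apply, LinearMap.restrictScalars_apply, hh,
        LinearMap.comp_apply, LinearMap.smul_apply, LinearMap.map_smul_of_tower,
        LinearMap.smul_apply, map_smul, LinearMap.id_apply, Submonoid.smul_def s₀, ← hj]
      change s • (algebraMap A B t) ^ j • f v = _
      rw [← map_pow, algebraMap_smul]
  refine ⟨m, π, s' • h', s' * s, j, fun v ↦ ?_⟩
  have := LinearMap.congr_fun hs' v
  simpa [mul_smul, Submonoid.smul_def] using this

end LocalizedSections

section Main

/-- The filtration by degree of a submodule of a free module over a polynomial ring. -/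
def Submodule.degreeFiltration {R : Type*} [CommRing R] {r : ℕ}
    (L : Submodule R[X] (Fin r → R[X])) (n : ℕ) : Submodule R L :=
  (Submodule.pi Set.univ fun _ ↦ degreeLT R n).comap (L.subtype.restrictScalars R)

lemma Submodule.mem_degreeFiltration {R : Type*} [CommRing R] {r : ℕ}
    {L : Submodule R[X] (Fin r → R[X])} {n : ℕ} {v : L} :
    v ∈ L.degreeFiltration n ↔ ∀ i j, n ≤ j → ((v : Fin r → R[X]) i).coeff j = 0 := by
  simp [Submodule.degreeFiltration, mem_degreeLT, degree_lt_iff_coeff_zero]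

variable {R : Type*} [CommRing R]

lemma Submodule.isDegreeFiltration_degreeFiltration {r : ℕ}
    (L : Submodule R[X] (Fin r → R[X])) : IsDegreeFiltration L.degreeFiltration where
  mono a b hab v hv := by
    rw [mem_degreeFiltration] at hv ⊢
    exact fun i j hj ↦ hv i j (hab.trans hj)
  zero := by
    rw [eq_bot_iff]
    intro v hv
    rw [mem_degreeFiltration] at hv
    exact Subtype.ext (funext fun i ↦ Polynomial.ext fun j ↦ hv i j j.zero_le)
  exists_mem v := by
    refine ⟨∑ i, ((v : Fin r → R[X]) i).natDegree + 1, mem_degreeFiltration.mpr fun i j hj ↦ ?_⟩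
    refine coeff_eq_zero_of_natDegree_lt (lt_of_lt_of_le (Nat.lt_succ_of_le ?_) hj)
    exact Finset.single_le_sum (f := fun i ↦ ((v : Fin r → R[X]) i).natDegree)
      (fun _ _ ↦ Nat.zero_le _) (Finset.mem_univ i)
  X_smul_mem_iff {n v} := by
    simp only [mem_degreeFiltration, Submodule.coe_smul, Pi.smul_apply, smul_eq_mul]
    constructor
    · intro h i j hj
      rw [← coeff_X_mul]
      exact h i (j + 1) (by omega)
    · rintro h i (_ | j) hj
      · omega
      · rw [coeff_X_mul]
        exact h i j (by omega)

instance Submodule.finite_degreeFiltration [IsNoetherianRing R] {r : ℕ}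
    (L : Submodule R[X] (Fin r → R[X])) (n : ℕ) : Module.Finite R (L.degreeFiltration n) := by
  have : Module.Finite R (degreeLT R n) := .equiv (degreeLTEquiv R n).symm
  let φ : L.degreeFiltration n →ₗ[R] (Fin r → degreeLT R n) :=
    .pi fun i ↦ (LinearMap.proj i ∘ₗ L.subtype.restrictScalars R ∘ₗ
      (L.degreeFiltration n).subtype).codRestrict _ fun v ↦ v.2 i (Set.mem_univ i)
  refine Module.Finite.of_injective φ fun v w h ↦ Subtype.ext (Subtype.ext (funext fun i ↦ ?_))
  exact congrArg Subtype.val (congrFun h i)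

lemma IsDegreeFiltration.exists_span_eq_top {L : Type*} [AddCommGroup L] [Module R L]
    [Module R[X] L] [Module.Finite R[X] L] {G : ℕ → Submodule R L} (hG : IsDegreeFiltration G) :
    ∃ n, Submodule.span R[X] (G (n + 1) : Set L) = ⊤ := by
  obtain ⟨m, l, hl⟩ := Module.Finite.exists_fin (R := R[X]) (M := L)
  choose N hN using fun i ↦ hG.exists_mem (l i)
  refine ⟨∑ i, N i, top_unique (hl ▸ Submodule.span_mono ?_)⟩
  rintro _ ⟨i, rfl⟩
  exact hG.mono ((Finset.single_le_sum (fun _ _ ↦ Nat.zero_le _) (Finset.mem_univ i)).trans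
    (Nat.le_succ _)) (hN i)

/-- Swan's lemma over a localization `A = M⁻¹R[X]`, where `R` is local and each product of an
element of `M` and a power of `X` takes a unit value at some point of `R`. -/
theorem exists_exact_of_isLocalization {R A P : Type} [CommRing R] [IsNoetherianRing R]
    [IsLocalRing R] [CommRing A] [Algebra R A] [Algebra R[X] A] [IsScalarTower R R[X] A]
    (M : Submonoid R[X]) [IsLocalization M A]
    (hM : ∀ g ∈ M, ∀ j : ℕ, ∃ a : R, IsUnit ((g * X ^ j).eval a))
    [AddCommGroup P] [Module A P] [Module.Finite A P]
    {r : ℕ} (emb : P →ₗ[A] (Fin r → A)) (hemb : Function.Injective emb)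
    [Module.Projective (Localization (Submonoid.powers (algebraMap R[X] A X)))
      (LocalizedModule (Submonoid.powers (algebraMap R[X] A X)) P)] :
    ∃ (Y : Type) (_ : AddCommGroup Y) (_ : Module R Y), Module.Finite R Y ∧
      ∃ (n : ℕ) (α : A ⊗[R] Y →ₗ[A] (A ⊗[R] Y) × (Fin n → A))
        (β : (A ⊗[R] Y) × (Fin n → A) →ₗ[A] P),
        Function.Injective α ∧ Function.Surjective β ∧
        LinearMap.ker β = LinearMap.range α := by
  let : Module R[X] P := Module.compHom P (algebraMap R[X] A)
  have : IsScalarTower R[X] A P := .of_algebraMap_smul fun _ _ ↦ rfl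
  obtain ⟨L, f, hf⟩ := exists_submodule_isLocalizedModule M emb hemb
  have := IsLocalization.isNoetherianRing M A inferInstance
  have := Module.finitePresentation_of_finite A P
  have := Module.finitePresentation_of_finite R[X] L
  obtain ⟨m, π, h, s, j, hπ⟩ :=
    exists_comp_eq_smul_id_of_isLocalizedModule (B := A) M f X
  obtain ⟨a, ha⟩ := hM s s.2 j
  have := projective_specialization π h _ hπ ha
  have hG := L.isDegreeFiltration_degreeFiltration
  obtain ⟨n, hn⟩ := hG.exists_span_eq_top
  obtain ⟨q, ⟨e⟩⟩ := hG.exists_equiv_prod hn a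
  let G := L.degreeFiltration
  let β₀ := (G (n + 1)).subtype.liftBaseChange R[X]
  have hβ₀ : Function.Surjective β₀ := by
    rw [← LinearMap.range_eq_top, ← top_le_iff, ← hn, Submodule.span_le]
    exact fun v hv ↦ ⟨1 ⊗ₜ ⟨v, hv⟩, by simp [β₀]⟩
  have : Module.Flat R[X] A := IsLocalization.flat A M
  let e' : A ⊗[R] G (n + 1) ≃ₗ[A] (A ⊗[R] G n) × (Fin q → A) :=
    e.symm.baseChange R A _ _ ≪≫ₗ TensorProduct.prodRight R A A _ _ ≪≫ₗ
      (LinearEquiv.refl A _).prodCongr (TensorProduct.piScalarRight R A A (Fin q))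
  let c (n : ℕ) := TensorProduct.AlgebraTensorModule.cancelBaseChange R R[X] A A (G n)
  let b : A ⊗[R[X]] L ≃ₗ[A] P := ((isLocalizedModule_iff_isBaseChange M A f).mp hf).equiv
  let u := c (n + 1) ≪≫ₗ e'
  have hinj : Function.Injective ((hG.swanMap n).baseChange A) :=
    Module.Flat.lTensor_preserves_injective_linearMap _ (hG.swanMap_injective n)
  have hex : Function.Exact ((hG.swanMap n).baseChange A) (β₀.baseChange A) :=
    lTensor_exact A (hG.swanMap_exact n) hβ₀
  refine ⟨G n, inferInstance, inferInstance, inferInstance, q,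
    u.toLinearMap ∘ₗ (hG.swanMap n).baseChange A ∘ₗ (c n).symm.toLinearMap,
    b.toLinearMap ∘ₗ β₀.baseChange A ∘ₗ u.symm.toLinearMap, ?_, ?_, ?_⟩
  · exact u.injective.comp (hinj.comp (c n).symm.injective)
  · exact b.surjective.comp ((LinearMap.lTensor_surjective A hβ₀).comp u.symm.surjective)
  · ext x
    rw [LinearMap.mem_ker]
    refine (b.map_eq_zero_iff.trans (hex (u.symm x))).trans ⟨?_, ?_⟩
    · rintro ⟨w, hw⟩
      exact ⟨c n w, by simp [hw]⟩
    · rintro ⟨w, rfl⟩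
      exact ⟨(c n).symm w, by simp⟩


attribute [local instance] Polynomial.algebra in
/-- `R ⊗[k] M⁻¹k[X]` as a localization of `R[X]`. -/
theorem isLocalization_tensorProduct_polynomial {k R V : Type*} [CommRing k] [CommRing R]
    [Algebra k R] [CommRing V] [Algebra k V] [Algebra k[X] V] [IsScalarTower k k[X] V]
    (M : Submonoid k[X]) [IsLocalization M V] [Algebra R[X] (R ⊗[k] V)]
    [IsScalarTower R R[X] (R ⊗[k] V)]
    (hX : algebraMap R[X] (R ⊗[k] V) X = 1 ⊗ₜ algebraMap k[X] V X) :
    IsLocalization (M.map (mapRingHom (algebraMap k R))) (R ⊗[k] V) := by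
  change IsLocalization (Algebra.algebraMapSubmonoid R[X] M) _
  let : Algebra V (R ⊗[k] V) := Algebra.TensorProduct.rightAlgebra
  let : Algebra k[X] (R ⊗[k] V) := .compHom _ (algebraMap k[X] V)
  have : IsScalarTower k[X] V (R ⊗[k] V) := .of_algebraMap_eq' rfl
  have : IsScalarTower k k[X] (R ⊗[k] V) := .of_algebraMap_eq fun x ↦
    ((Algebra.TensorProduct.includeRight (A := R) (B := V)).commutes x).symm.trans
      (congrArg _ (IsScalarTower.algebraMap_apply k k[X] V x))
  have : IsScalarTower k R[X] (R ⊗[k] V) := .to₁₃₄ _ R _ _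
  have : IsScalarTower k[X] R[X] (R ⊗[k] V) := .of_algebraMap_eq' <| by
    refine Polynomial.ringHom_ext' (RingHom.ext fun a ↦ ?_) ?_
    · change algebraMap k[X] (R ⊗[k] V) (algebraMap k k[X] a) =
        algebraMap R[X] (R ⊗[k] V) (map (algebraMap k R) (C a))
      rw [← IsScalarTower.algebraMap_apply, map_C, C_eq_algebraMap,
        ← IsScalarTower.algebraMap_apply, ← IsScalarTower.algebraMap_apply]
    · change 1 ⊗ₜ algebraMap k[X] V X = algebraMap R[X] (R ⊗[k] V) (map (algebraMap k R) X)
      rw [map_X, hX]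
  rw [Algebra.isLocalization_iff_isPushout _ V, Algebra.IsPushout.comm,
    ← Algebra.IsPushout.comp_iff k _ R]
  infer_instance

lemma Polynomial.exists_isUnit_eval_map {k R : Type*} [Field k] [Infinite k] [CommRing R]
    [Algebra k R] {p : k[X]} (hp : p ≠ 0) : ∃ a : R, IsUnit ((p.map (algebraMap k R)).eval a) := by
  obtain ⟨a, ha⟩ : ∃ a, p.eval a ≠ 0 := by
    by_contra! h
    exact hp (Polynomial.funext fun a ↦ by rw [h, eval_zero])
  refine ⟨algebraMap k R a, ?_⟩
  rw [eval_map_algebraMap, aeval_algebraMap_apply_eq_algebraMap_eval]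
  exact (IsUnit.mk0 _ ha).map _

end Main


end Helpers

/-- **Yoshino, Lemma 6.3 (a consequence of Swan's Lemma).**  Let `k` be an infinite field,
`(R, 𝔪, k)` a noetherian local `k`-algebra, `V = k[t]_(t)` and `K = k(t)`.  Let `P′` be a
finitely generated `R ⊗_k V`-module which is (1) a submodule of a finitely generated free
`R ⊗_k V`-module and such that (2) the localization `P = P′_t` is a projective
`R ⊗_k K = (R ⊗_k V)[1/t]`-module.  Then there is a short exact sequence of
`R ⊗_k V`-modules `0 → X ⊗_k V → (X ⊗_k V) ⊕ (R^n ⊗_k V) → P′ → 0` with `X` a finitely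
generated `R`-module and `n ∈ ℕ`; here `X ⊗_k V` is the base change `(R ⊗_k V) ⊗_R X` and
`R^n ⊗_k V` is the free module `(R ⊗_k V)^n`. -/
theorem swan_lemma_local
    (k : Type) [Field k] [Infinite k]
    (R : Type) [CommRing R] [Algebra k R] [IsNoetherianRing R] [IsLocalRing R]
    (hres : Function.Bijective (algebraMap k (R ⧸ IsLocalRing.maximalIdeal R)))
    (V : Type) [CommRing V] [Algebra k V] [Algebra (Polynomial k) V]
    [IsScalarTower k (Polynomial k) V]
    [IsLocalization.AtPrime V (Ideal.span {(Polynomial.X : Polynomial k)})]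
    (P' : Type) [AddCommGroup P'] [Module (R ⊗[k] V) P']
    (hfg : Module.Finite (R ⊗[k] V) P')
    (hsub : ∃ (r : ℕ) (emb : P' →ₗ[R ⊗[k] V] (Fin r → R ⊗[k] V)), Function.Injective emb)
    (hproj : Module.Projective
      (Localization (Submonoid.powers
        ((1:R) ⊗ₜ[k] (algebraMap (Polynomial k) V Polynomial.X) : R ⊗[k] V)))
      (LocalizedModule (Submonoid.powers
        ((1:R) ⊗ₜ[k] (algebraMap (Polynomial k) V Polynomial.X) : R ⊗[k] V)) P')) :
    ∃ (X : Type) (_ : AddCommGroup X) (_ : Module R X), Module.Finite R X ∧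
      ∃ (n : ℕ)
        (α : ((R ⊗[k] V) ⊗[R] X) →ₗ[R ⊗[k] V]
          (((R ⊗[k] V) ⊗[R] X) × (Fin n → R ⊗[k] V)))
        (β : (((R ⊗[k] V) ⊗[R] X) × (Fin n → R ⊗[k] V)) →ₗ[R ⊗[k] V] P'),
        Function.Injective α ∧ Function.Surjective β ∧
        LinearMap.ker β = LinearMap.range α := by
  let : Algebra (Polynomial R) (R ⊗[k] V) :=
    (Polynomial.aeval (1 ⊗ₜ[k] algebraMap (Polynomial k) V Polynomial.X)).toAlgebra
  have : IsScalarTower R (Polynomial R) (R ⊗[k] V) := .of_algebraMap_eq fun x ↦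
    ((Polynomial.aeval (1 ⊗ₜ[k] algebraMap (Polynomial k) V Polynomial.X)).commutes x).symm
  have hX : algebraMap (Polynomial R) (R ⊗[k] V) Polynomial.X =
      1 ⊗ₜ algebraMap (Polynomial k) V Polynomial.X := Polynomial.aeval_X _
  have := isLocalization_tensorProduct_polynomial
    (Ideal.span {(Polynomial.X : Polynomial k)}).primeCompl hX
  rw [← hX] at hproj
  obtain ⟨r, emb, hemb⟩ := hsub
  refine exists_exact_of_isLocalization
    ((Ideal.span {(Polynomial.X : Polynomial k)}).primeCompl.map
      (Polynomial.mapRingHom (algebraMap k R))) ?_ emb hemb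
  rintro _ ⟨p, hp, rfl⟩ j
  have hp0 : p ≠ 0 := fun h ↦ hp (h ▸ Ideal.zero_mem _)
  obtain ⟨a, ha⟩ := Polynomial.exists_isUnit_eval_map (R := R)
    (mul_ne_zero hp0 (pow_ne_zero j Polynomial.X_ne_zero))
  exact ⟨a, by simpa using ha⟩

end
end

section
/- Let k be an infinite field, (R, 𝔪, k) a Gorenstein local ring that is a k-algebra, and K = k(t). Given a finitely generated projective R⊗_k K-module P, there exist a Cohen–Macaulay R-module X and a non-negative integer n such that P ⊕ (X⊗_k K) ≅ (R^n⊗_k K) ⊕ (X⊗_k K) as R⊗_k K-modules. -/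
open TensorProduct CategoryTheory

noncomputable section

set_option maxHeartbeats 1000000
set_option synthInstance.maxHeartbeats 400000

/-- A finitely generated module `M` over a commutative (Gorenstein) ring `A` is
(maximal) Cohen–Macaulay if `Ext^i_A(M, A) = 0` for all `i > 0`. -/
def IsCMModule (A : Type) [CommRing A] (M : Type) [AddCommGroup M] [Module A M] : Prop :=
  Module.Finite A M ∧ ∀ i : ℕ, 0 < i →
    Subsingleton (((Ext A (ModuleCat A) i).obj
      (Opposite.op (ModuleCat.of A M))).obj (ModuleCat.of A A))

/-- A Gorenstein local ring: a commutative noetherian local ring which has finite injective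
dimension as a module over itself, the latter being expressed by the vanishing of
`Ext^i(-, R)` for all `i` bigger than some fixed `n`. -/
def IsGorensteinLocalRing (R : Type) [CommRing R] : Prop :=
  IsNoetherianRing R ∧ IsLocalRing R ∧
  ∃ n : ℕ, ∀ (M : ModuleCat R) (i : ℕ), n < i →
    Subsingleton (((Ext R (ModuleCat R) i).obj (Opposite.op M)).obj (ModuleCat.of R R))

/-- The ring `R ⊗_k K` with `K = k(t)` the rational function field. -/
def AK (k : Type) [Field k] (R : Type) [CommRing R] [Algebra k R] : Type :=
  R ⊗[k] RatFunc k

instance (k : Type) [Field k] (R : Type) [CommRing R] [Algebra k R] :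
    CommRing (AK k R) := inferInstanceAs (CommRing (R ⊗[k] RatFunc k))

instance (k : Type) [Field k] (R : Type) [CommRing R] [Algebra k R] :
    Algebra k (AK k R) := inferInstanceAs (Algebra k (R ⊗[k] RatFunc k))

instance (k : Type) [Field k] (R : Type) [CommRing R] [Algebra k R] :
    Algebra R (AK k R) := inferInstanceAs (Algebra R (R ⊗[k] RatFunc k))

/-- The derived-functor `Ext` vanishes in a positive degree iff the derived-category `Ext` does. -/
theorem subsingleton_ext_iff (R : Type) [CommRing R] (M N : ModuleCat.{0} R) (n : ℕ) :
    Subsingleton (((Ext R (ModuleCat.{0} R) (n + 1)).obj (Opposite.op M)).obj N) ↔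
      Subsingleton (Abelian.Ext M N (n + 1)) := by
  let P := projectiveResolution M
  have h1 : Subsingleton (((Ext R (ModuleCat.{0} R) (n + 1)).obj (Opposite.op M)).obj N) ↔
      ((P.complex.linearYonedaObj R N).sc' n (n + 1) (n + 2)).Exact := by
    rw [(P.isoExt (R := R) (n + 1) N).toLinearEquiv.toEquiv.subsingleton_congr,
      ← HomologicalComplex.exactAt_iff' _ n (n + 1) (n + 2) (by simp) (by simp),
      HomologicalComplex.exactAt_iff_isZero_homology]
    exact ⟨fun h => ModuleCat.isZero_of_subsingleton _, fun h => ModuleCat.subsingleton_of_isZero h⟩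
  rw [h1, ShortComplex.moduleCat_exact_iff]
  constructor
  · intro h
    refine subsingleton_of_forall_eq 0 fun α => ?_
    obtain ⟨f, hf, rfl⟩ := P.extMk_surjective α (n + 2) rfl
    exact (P.extMk_eq_zero_iff f (n + 2) rfl hf n rfl).2 (h f hf)
  · intro h f hf
    exact (P.extMk_eq_zero_iff (n := n + 1) f (n + 2) rfl hf n rfl).1 (Subsingleton.elim _ _)

/-- `Ext^i(M, R)` vanishes for all `i > n`. -/
def ExtVanishesAbove (R : Type) [CommRing R] (n : ℕ) (M : Type) [AddCommGroup M] [Module R M] :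
    Prop :=
  ∀ i, n < i → Subsingleton (Abelian.Ext (ModuleCat.of R M) (ModuleCat.of R R) i)

theorem isCMModule_of_extVanishesAbove {R : Type} [CommRing R] {M : Type} [AddCommGroup M]
    [Module R M] [hM : Module.Finite R M] (h : ExtVanishesAbove R 0 M) : IsCMModule R M := by
  refine ⟨hM, fun i hi => ?_⟩
  obtain ⟨j, rfl⟩ := Nat.exists_eq_add_of_lt hi
  exact (subsingleton_ext_iff R _ _ _).2 (h _ (by omega))

theorem IsGorensteinLocalRing.exists_extVanishesAbove {R : Type} [CommRing R]
    (h : IsGorensteinLocalRing R) :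
    ∃ n, ∀ (M : Type) [AddCommGroup M] [Module R M], ExtVanishesAbove R n M := by
  obtain ⟨-, -, n, hn⟩ := h
  refine ⟨n, fun M _ _ i hi => ?_⟩
  obtain ⟨j, rfl⟩ := Nat.exists_eq_add_of_lt (Nat.zero_lt_of_lt hi)
  exact (subsingleton_ext_iff R _ _ _).1 (hn _ _ hi)

theorem ExtVanishesAbove.ker {R : Type} [CommRing R] {n : ℕ} {F M : Type}
    [AddCommGroup M] [Module R M] [AddCommGroup F] [Module R F] [Module.Projective R F]
    (f : F →ₗ[R] M) (hf : Function.Surjective f) (hM : ExtVanishesAbove R (n + 1) M) :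
    ExtVanishesAbove R n (LinearMap.ker f) := by
  intro i hi
  have hS := LinearMap.shortExact_shortComplexKer hf
  have : Projective (ModuleCat.of R F) := (IsProjective.iff_projective (P := F)).1 inferInstance
  refine subsingleton_of_forall_eq 0 fun x => ?_
  obtain ⟨y, rfl⟩ := Abelian.Ext.contravariant_sequence_exact₁ hS (ModuleCat.of R R) x
    (add_comm _ _) (@Subsingleton.elim _ (hM (i + 1) (by omega)) _ _)
  obtain ⟨j, rfl⟩ := Nat.exists_eq_add_of_lt (Nat.zero_lt_of_lt hi)
  rw [show y = 0 from y.eq_zero_of_projective, Abelian.Ext.comp_zero]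

theorem ExtVanishesAbove.prod_of_projective {R : Type} [CommRing R] {n : ℕ} {F M : Type}
    [AddCommGroup M] [Module R M] [AddCommGroup F] [Module R F] [Module.Projective R F]
    (hM : ExtVanishesAbove R n M) : ExtVanishesAbove R n (M × F) := by
  intro i hi
  have : Projective (ModuleCat.of R F) := (IsProjective.iff_projective (P := F)).1 inferInstance
  have hS := ModuleCat.shortComplex_shortExact (ModuleCat.shortComplexOfCompEqZero
    (LinearMap.inl R M F) (LinearMap.snd R M F) (by ext; simp))
    (by exact Function.Exact.inl_snd) (by exact LinearMap.inl_injective)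
    (by exact LinearMap.snd_surjective)
  refine subsingleton_of_forall_eq 0 fun x => ?_
  obtain ⟨y, rfl⟩ := Abelian.Ext.contravariant_sequence_exact₂ hS (ModuleCat.of R R) x
    (@Subsingleton.elim _ (hM i hi) _ _)
  obtain ⟨j, rfl⟩ := Nat.exists_eq_add_of_lt (Nat.zero_lt_of_lt hi)
  have : Projective (ModuleCat.shortComplexOfCompEqZero
    (LinearMap.inl R M F) (LinearMap.snd R M F) (by ext; simp)).X₃ := by assumption
  rw [show y = 0 from y.eq_zero_of_projective, Abelian.Ext.comp_zero]

theorem nonempty_linearEquiv_pullback {A Y M N M' : Type*} [CommRing A]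
    [AddCommGroup Y] [Module A Y] [AddCommGroup M] [Module A M] [AddCommGroup N] [Module A N]
    [AddCommGroup M'] [Module A M'] [Module.Projective A M']
    (i : Y →ₗ[A] M) (f : M →ₗ[A] N) (g : M' →ₗ[A] N) (hi : Function.Injective i)
    (hif : Function.Exact i f) (hf : Function.Surjective f) :
    Nonempty ((Y × M') ≃ₗ[A] LinearMap.ker (f.coprod (-g))) := by
  obtain ⟨h, hh⟩ := Module.projective_lifting_property f g hf
  have hh' : ∀ m, f (h m) = g m := fun m => LinearMap.congr_fun hh m
  let φ : (Y × M') →ₗ[A] M × M' := (i.coprod h).prod (LinearMap.snd A Y M')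
  have hφ : ∀ z, φ z ∈ LinearMap.ker (f.coprod (-g)) := by
    rintro ⟨y, m⟩
    simp [φ, hh', hif.apply_apply_eq_zero]
  refine ⟨LinearEquiv.ofBijective (φ.codRestrict _ hφ) ⟨?_, ?_⟩⟩
  · rw [← LinearMap.ker_eq_bot, LinearMap.ker_codRestrict, LinearMap.ker_eq_bot']
    rintro ⟨y, m⟩ h0
    obtain ⟨h1, rfl⟩ : i y + h m = 0 ∧ m = 0 := Prod.mk_eq_zero.1 h0
    rw [map_zero, add_zero] at h1
    rw [(map_eq_zero_iff i hi).1 h1]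
    rfl
  · rintro ⟨⟨m, m'⟩, hm⟩
    have hm' : f m = g m' := by
      simpa [← sub_eq_add_neg, sub_eq_zero] using hm
    obtain ⟨y, hy⟩ := (hif (m - h m')).1 (by rw [map_sub, hh', hm', sub_self])
    exact ⟨(y, m'), by ext <;> simp [φ, hy]⟩

/-- Schanuel's lemma. -/
theorem schanuel {A Y M N Y' M' : Type*} [CommRing A]
    [AddCommGroup Y] [Module A Y] [AddCommGroup M] [Module A M] [AddCommGroup N] [Module A N]
    [AddCommGroup Y'] [Module A Y'] [AddCommGroup M'] [Module A M']
    [Module.Projective A M] [Module.Projective A M']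
    (i : Y →ₗ[A] M) (f : M →ₗ[A] N) (hi : Function.Injective i)
    (hif : Function.Exact i f) (hf : Function.Surjective f)
    (j : Y' →ₗ[A] M') (g : M' →ₗ[A] N) (hj : Function.Injective j)
    (hjg : Function.Exact j g) (hg : Function.Surjective g) :
    Nonempty ((Y × M') ≃ₗ[A] (Y' × M)) := by
  obtain ⟨e⟩ := nonempty_linearEquiv_pullback i f g hi hif hf
  obtain ⟨e'⟩ := nonempty_linearEquiv_pullback j g f hj hjg hg
  have key : (LinearMap.ker (f.coprod (-g))).map
      (LinearEquiv.prodComm A M M' : (M × M') →ₗ[A] M' × M) = LinearMap.ker (g.coprod (-f)) := by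
    ext ⟨m', m⟩
    simp only [Submodule.mem_map, LinearMap.mem_ker, LinearMap.coprod_apply, LinearMap.neg_apply,
      Prod.exists, LinearEquiv.coe_coe, LinearEquiv.prodComm_apply, Prod.swap_prod_mk,
      Prod.mk.injEq, ← sub_eq_add_neg, sub_eq_zero]
    constructor
    · rintro ⟨a, b, h, rfl, rfl⟩
      exact h.symm
    · intro h
      exact ⟨m, m', h.symm, rfl, rfl⟩
  exact ⟨e.trans (((LinearEquiv.prodComm A M M').submoduleMap _).trans
    ((LinearEquiv.ofEq _ _ key).trans e'.symm))⟩

/-- A stable isomorphism `P ⊕ X_A ≅ A^n ⊕ X_A` over a flat `R`-algebra `A` persists when `X` is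
replaced by a syzygy plus a free module. -/
theorem exists_syzygy {R A : Type} [CommRing R] [IsNoetherianRing R] [CommRing A] [Algebra R A]
    [Module.Flat R A] {P : Type} [AddCommGroup P] [Module A P] [Module.Projective A P] {n d : ℕ}
    {X : Type} [AddCommGroup X] [Module R X] [Module.Finite R X]
    (hX : ExtVanishesAbove R (d + 1) X)
    (e : (P × (A ⊗[R] X)) ≃ₗ[A] ((Fin n → A) × (A ⊗[R] X))) :
    ∃ (Y : Type) (_ : AddCommGroup Y) (_ : Module R Y), Module.Finite R Y ∧
      ExtVanishesAbove R d Y ∧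
      Nonempty ((P × (A ⊗[R] Y)) ≃ₗ[A] ((Fin n → A) × (A ⊗[R] Y))) := by
  obtain ⟨m, π, hπ⟩ := Module.Finite.exists_fin' R X
  let Z := LinearMap.ker π
  let i : A ⊗[R] Z →ₗ[A] A ⊗[R] (Fin m → R) := Z.subtype.baseChange A
  let p : A ⊗[R] (Fin m → R) →ₗ[A] A ⊗[R] X := π.baseChange A
  have hi : Function.Injective i :=
    Module.Flat.lTensor_preserves_injective_linearMap Z.subtype Z.injective_subtype
  have hp : Function.Surjective p := LinearMap.lTensor_surjective A hπ
  have hip : Function.Exact i p := lTensor_exact A (LinearMap.exact_subtype_ker_map π) hπ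
  have key : ∀ (Q : Type) [AddCommGroup Q] [Module A Q],
      Function.Injective ((LinearMap.inr A Q _).comp i) ∧
      Function.Exact ((LinearMap.inr A Q _).comp i) (LinearMap.prodMap LinearMap.id p) ∧
      Function.Surjective (LinearMap.prodMap (LinearMap.id : Q →ₗ[A] Q) p) := by
    intro Q _ _
    refine ⟨LinearMap.inr_injective.comp hi, ?_, ?_⟩
    · rintro ⟨q, z⟩
      simp only [LinearMap.prodMap_apply, LinearMap.id_apply, Prod.mk_eq_zero, hip z,
        Set.mem_range, LinearMap.comp_apply, LinearMap.inr_apply, Prod.mk.injEq]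
      constructor
      · rintro ⟨rfl, y, rfl⟩
        exact ⟨y, rfl, rfl⟩
      · rintro ⟨y, rfl, rfl⟩
        exact ⟨rfl, y, rfl⟩
    · exact Function.Surjective.prodMap Function.surjective_id hp
  obtain ⟨h1, h2, h3⟩ := key P
  obtain ⟨h1', h2', h3'⟩ := key (Fin n → A)
  obtain ⟨s⟩ := schanuel _ (e.toLinearMap ∘ₗ LinearMap.prodMap LinearMap.id p) h1
    (by
      intro z
      rw [← h2 z]
      simp) (e.surjective.comp h3) _ _ h1' h2' h3'
  refine ⟨Z × (Fin m → R), inferInstance, inferInstance, inferInstance,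
    (hX.ker π hπ).prod_of_projective, ⟨?_⟩⟩
  let F := A ⊗[R] (Fin m → R)
  let c : A ⊗[R] (Z × (Fin m → R)) ≃ₗ[A] (A ⊗[R] Z) × F := TensorProduct.prodRight R A A Z _
  let t : ∀ (Q : Type) [AddCommGroup Q] [Module A Q],
      (Q × (A ⊗[R] (Z × (Fin m → R)))) ≃ₗ[A] (A ⊗[R] Z) × (Q × F) := fun Q _ _ =>
    (LinearEquiv.prodCongr (LinearEquiv.refl A Q) c).trans <|
      (LinearEquiv.prodAssoc A Q (A ⊗[R] Z) F).symm.trans <|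
      (LinearEquiv.prodCongr (LinearEquiv.prodComm A Q (A ⊗[R] Z)) (LinearEquiv.refl A F)).trans <|
      LinearEquiv.prodAssoc A (A ⊗[R] Z) Q F
  exact (t P).trans (s.symm.trans (t (Fin n → A)).symm)

theorem exists_isCMModule_of_finite {R A : Type} [CommRing R] [CommRing A] [Algebra R A]
    (hR : IsGorensteinLocalRing R)
    [Module.Flat R A] {P : Type} [AddCommGroup P] [Module A P] [Module.Projective A P] {n : ℕ}
    {X : Type} [AddCommGroup X] [Module R X] [Module.Finite R X]
    (e : (P × (A ⊗[R] X)) ≃ₗ[A] ((Fin n → A) × (A ⊗[R] X))) :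
    ∃ (Y : Type) (_ : AddCommGroup Y) (_ : Module R Y), IsCMModule R Y ∧
      Nonempty ((P × (A ⊗[R] Y)) ≃ₗ[A] ((Fin n → A) × (A ⊗[R] Y))) := by
  have := hR.1
  obtain ⟨d, hd⟩ := hR.exists_extVanishesAbove
  have hX : ExtVanishesAbove R d X := hd X
  clear hd
  induction d generalizing X with
  | zero => exact ⟨X, _, _, isCMModule_of_extVanishesAbove hX, ⟨e⟩⟩
  | succ d ih =>
    obtain ⟨Y, _, _, _, hY, ⟨e'⟩⟩ := exists_syzygy hX e
    exact ih e' hY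

/-- For an injective endomorphism `T` of a module over a noetherian ring, every finitely generated
submodule lies in finitely generated `X₁ ≤ X₀` with `T X₁ ≤ X₀` such that, inside a `T`-stable
submodule `Q` containing `X₀`, the preimage of `X₀` is contained in `X₁`. -/
theorem exists_saturated_lattices {R P : Type*} [CommRing R] [IsNoetherianRing R]
    [AddCommGroup P] [Module R P] (T : P →ₗ[R] P) (hT : Function.Injective T)
    (Q₀ : Submodule R P) (hQ₀ : Q₀.FG) :
    ∃ X₁ X₀ Q : Submodule R P, X₁.FG ∧ X₀.FG ∧ Q₀ ≤ X₁ ∧ X₁ ≤ X₀ ∧ X₀ ≤ Q ∧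
      (∀ x ∈ Q, T x ∈ Q) ∧ (∀ x ∈ X₁, T x ∈ X₀) ∧ (∀ x ∈ Q, T x ∈ X₀ → x ∈ X₁) := by
  let F : ℕ → Submodule R P := fun n => Nat.rec Q₀ (fun _ S => Q₀ ⊔ S.map T) n
  have F_succ : ∀ n, F (n + 1) = Q₀ ⊔ (F n).map T := fun _ => rfl
  have F_fg : ∀ n, (F n).FG := fun n => by
    induction n with
    | zero => exact hQ₀
    | succ n ih => exact hQ₀.sup (ih.map T)
  have F_mono : Monotone F := monotone_nat_of_le_succ fun n => by
    induction n with
    | zero => exact le_sup_left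
    | succ n ih => exact sup_le_sup_left (Submodule.map_mono ih) _
  have F_map : ∀ n, ∀ x ∈ F n, T x ∈ F (n + 1) := fun n x hx =>
    le_sup_right (a := Q₀) (Submodule.mem_map_of_mem hx)
  let Q : Submodule R P := ⨆ n, F n
  have mem_Q : ∀ x, x ∈ Q ↔ ∃ n, x ∈ F n := fun x =>
    Submodule.mem_iSup_of_directed F F_mono.directed_le
  let W : Submodule R P := Q₀.comap T ⊓ Q
  have hW : W.FG := by
    have hle : W.map T ≤ Q₀ := (Submodule.map_mono inf_le_left).trans (Submodule.map_comap_le _ _)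
    have : IsNoetherian R Q₀ := isNoetherian_of_fg_of_noetherian _ hQ₀
    exact Submodule.fg_of_fg_map_injective T hT (isNoetherian_submodule.1 this _ hle)
  obtain ⟨n, hn⟩ : ∃ n, W ≤ F n := by
    obtain ⟨_, ⟨n, rfl⟩, hn⟩ := (CompleteLattice.isCompactElement_iff_le_of_directed_sSup_le _ W).1
      ((Submodule.fg_iff_compact W).1 hW) (Set.range F) (Set.range_nonempty F)
      F_mono.directed_le.directedOn_range (inf_le_right.trans (le_of_eq sSup_range.symm))
    exact ⟨n, hn⟩
  refine ⟨F n, F (n + 1), Q, F_fg n, F_fg (n + 1), F_mono (Nat.zero_le n), F_mono n.le_succ,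
    le_iSup F (n + 1), fun x hx => ?_, F_map n, fun x hx hTx => ?_⟩
  · obtain ⟨m, hm⟩ := (mem_Q x).1 hx
    exact (mem_Q _).2 ⟨m + 1, F_map m x hm⟩
  · rw [F_succ, Submodule.mem_sup] at hTx
    obtain ⟨y, hy, _, ⟨z, hz, rfl⟩, h⟩ := hTx
    have : x - z ∈ F n := hn ⟨by
      change T (x - z) ∈ Q₀
      rw [map_sub, ← h, add_sub_cancel_right]
      exact hy, Q.sub_mem hx ((mem_Q z).2 ⟨n, hz⟩)⟩
    simpa using (F n).add_mem this hz

section Powers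

variable {R B : Type} [CommRing R] [CommRing B] [Algebra R B] (τ : B)

/-- The map sending a polynomial `∑ xᵢ tⁱ` with coefficients in `X` to `∑ τⁱ ⊗ xᵢ`. -/
def evalTensor (R : Type) {B : Type} [CommRing R] [CommRing B] [Algebra R B] (τ : B) (X : Type)
    [AddCommGroup X] [Module R X] : (ℕ →₀ X) →ₗ[R] B ⊗[R] X :=
  Finsupp.lsum R fun i => TensorProduct.mk R B X (τ ^ i)

theorem evalTensor_single {X : Type} [AddCommGroup X] [Module R X] (i : ℕ) (x : X) :
    evalTensor R τ X (Finsupp.single i x) = (τ ^ i) ⊗ₜ[R] x := by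
  simp [evalTensor]

theorem smul_evalTensor {X : Type} [AddCommGroup X] [Module R X] (f : ℕ →₀ X) :
    τ • evalTensor R τ X f = evalTensor R τ X (Finsupp.lmapDomain X R Nat.succ f) := by
  induction f using Finsupp.induction_linear with
  | zero => simp
  | add f g hf hg => simp only [map_add, smul_add, hf, hg]
  | single i x =>
    rw [Finsupp.lmapDomain_apply, Finsupp.mapDomain_single, evalTensor_single, evalTensor_single,
      TensorProduct.smul_tmul', smul_eq_mul, pow_succ']

theorem baseChange_evalTensor {X Y : Type} [AddCommGroup X] [Module R X] [AddCommGroup Y]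
    [Module R Y] (g : X →ₗ[R] Y) (f : ℕ →₀ X) :
    g.baseChange B (evalTensor R τ X f) = evalTensor R τ Y (Finsupp.mapRange.linearMap g f) := by
  induction f using Finsupp.induction_linear with
  | zero => simp
  | add f g hf hg => simp only [map_add, hf, hg]
  | single i x =>
    rw [Finsupp.mapRange.linearMap_apply, Finsupp.mapRange_single, evalTensor_single,
      evalTensor_single, LinearMap.baseChange_tmul]

variable {τ}

theorem evalTensor_injective {X : Type} [AddCommGroup X] [Module R X] {c : ℕ → B →ₗ[R] R}
    (hc : ∀ i j, c i (τ ^ j) = if i = j then 1 else 0) :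
    Function.Injective (evalTensor R τ X) := by
  have key : ∀ i f, TensorProduct.lid R X ((c i).rTensor X (evalTensor R τ X f)) = f i := by
    intro i f
    induction f using Finsupp.induction_linear with
    | zero => simp
    | add f g hf hg => simp only [map_add, hf, hg, Finsupp.add_apply]
    | single j x =>
      rw [evalTensor_single, LinearMap.rTensor_tmul, hc, TensorProduct.lid_tmul,
        Finsupp.single_apply]
      simp only [eq_comm (a := i), ite_smul, one_smul, zero_smul]
  intro f g h
  ext i
  rw [← key, ← key, h]

theorem exists_unit_smul_eq_evalTensor {X : Type} [AddCommGroup X] [Module R X]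
    (hB : ∀ b : B, ∃ h ∈ Algebra.adjoin R {τ}, IsUnit h ∧ h * b ∈ Algebra.adjoin R {τ})
    (z : B ⊗[R] X) : ∃ h ∈ Algebra.adjoin R {τ}, IsUnit h ∧ ∃ f, h • z = evalTensor R τ X f := by
  have stable : ∀ b ∈ Algebra.adjoin R {τ}, ∀ f, ∃ g,
      b • evalTensor R τ X f = evalTensor R τ X g := by
    intro b hb
    induction hb using Algebra.adjoin_induction with
    | mem x hx =>
      rw [Set.mem_singleton_iff.1 hx]
      exact fun f => ⟨_, smul_evalTensor τ f⟩
    | algebraMap r => exact fun f => ⟨r • f, by rw [map_smul, algebraMap_smul]⟩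
    | add x y _ _ hx hy =>
      intro f
      obtain ⟨g, hg⟩ := hx f
      obtain ⟨g', hg'⟩ := hy f
      exact ⟨g + g', by rw [add_smul, map_add, hg, hg']⟩
    | mul x y _ _ hx hy =>
      intro f
      obtain ⟨g, hg⟩ := hy f
      obtain ⟨g', hg'⟩ := hx g
      exact ⟨g', by rw [mul_smul, hg, hg']⟩
  induction z using TensorProduct.induction_on with
  | zero => exact ⟨1, one_mem _, isUnit_one, 0, by simp⟩
  | tmul b x =>
    obtain ⟨h, hh, hu, hb⟩ := hB b
    obtain ⟨g, hg⟩ := stable _ hb (Finsupp.single 0 x)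
    refine ⟨h, hh, hu, g, ?_⟩
    rw [← hg, evalTensor_single, TensorProduct.smul_tmul', TensorProduct.smul_tmul', pow_zero,
      smul_eq_mul, smul_eq_mul, mul_one]
  | add y z hy hz =>
    obtain ⟨h, hh, hu, f, hf⟩ := hy
    obtain ⟨h', hh', hu', f', hf'⟩ := hz
    obtain ⟨g, hg⟩ := stable _ hh' f
    obtain ⟨g', hg'⟩ := stable _ hh f'
    refine ⟨h' * h, mul_mem hh' hh, hu'.mul hu, g + g', ?_⟩
    rw [smul_add, map_add, ← hg, ← hg', mul_smul, hf, mul_comm, mul_smul, hf']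

/-- If `B` is a localization of a polynomial ring `R[τ]` in which `τ` is invertible, every finitely
generated projective `B`-module is stably a difference of modules extended from `R`. -/
theorem exists_extended_decomposition [IsNoetherianRing R] (hτ : IsUnit τ) (c : ℕ → B →ₗ[R] R)
    (hc : ∀ i j, c i (τ ^ j) = if i = j then 1 else 0)
    (hB : ∀ b : B, ∃ h ∈ Algebra.adjoin R {τ}, IsUnit h ∧ h * b ∈ Algebra.adjoin R {τ})
    (P : Type) [AddCommGroup P] [Module B P] [Module.Finite B P] [Module.Projective B P] :
    ∃ (X₁ X₀ : Type) (_ : AddCommGroup X₁) (_ : Module R X₁) (_ : AddCommGroup X₀)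
      (_ : Module R X₀), Module.Finite R X₁ ∧ Module.Finite R X₀ ∧
      Nonempty ((B ⊗[R] X₀) ≃ₗ[B] (P × (B ⊗[R] X₁))) := by
  let _ : Module R P := Module.compHom P (algebraMap R B)
  have : IsScalarTower R B P := IsScalarTower.of_algebraMap_smul fun _ _ => rfl
  let T : P →ₗ[R] P := (LinearMap.lsmul B P τ).restrictScalars R
  have T_apply : ∀ p, T p = τ • p := fun _ => rfl
  have hT : Function.Injective T := fun _ _ h => hτ.smul_left_cancel.1 h
  obtain ⟨s, hs⟩ := Module.Finite.fg_top (R := B) (M := P)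
  obtain ⟨X₁, X₀, Q, h₁, h₀, hs₁, h₁₀, h₀Q, hTQ, hT₁, hT₀⟩ :=
    exists_saturated_lattices T hT (Submodule.span R (s : Set P)) ⟨s, rfl⟩
  let T₁ : X₁ →ₗ[R] X₀ := T.restrict hT₁
  let φ : B ⊗[R] X₁ →ₗ[B] B ⊗[R] X₀ :=
    T₁.baseChange B - τ • (Submodule.inclusion h₁₀).baseChange B
  let π : B ⊗[R] X₀ →ₗ[B] P := X₀.subtype.liftBaseChange B
  have hπ : Function.Surjective π := by
    rw [← LinearMap.range_eq_top, eq_top_iff, ← hs, Submodule.span_le]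
    intro x hx
    exact ⟨1 ⊗ₜ ⟨x, h₁₀ (hs₁ (Submodule.subset_span hx))⟩, by simp [π]⟩
  have φ_tmul : ∀ (b : B) (x : X₁),
      φ (b ⊗ₜ x) = b ⊗ₜ[R] T₁ x - (τ * b) ⊗ₜ[R] Submodule.inclusion h₁₀ x := fun b x => by
    simp [φ, TensorProduct.smul_tmul']
  have hφ : Function.Injective φ := by
    rw [injective_iff_map_eq_zero]
    intro z hz
    obtain ⟨h, -, hu, f, hf⟩ := exists_unit_smul_eq_evalTensor hB z
    have h0 : Finsupp.mapRange.linearMap T₁ f - Finsupp.lmapDomain X₀ R Nat.succ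
        (Finsupp.mapRange.linearMap (Submodule.inclusion h₁₀) f) = 0 := by
      apply evalTensor_injective hc
      rw [map_sub, ← smul_evalTensor, ← baseChange_evalTensor, ← baseChange_evalTensor, map_zero]
      change φ (evalTensor R τ X₁ f) = 0
      rw [← hf, map_smul, hz, smul_zero]
    have hf0 : ∀ i, f i = 0 := by
      intro i
      have hi := DFunLike.congr_fun h0 i
      have hT₁' : ∀ x, T₁ x = 0 → x = 0 := fun x hx =>
        Subtype.ext (hT ((congrArg Subtype.val hx).trans (map_zero T).symm))
      induction i with
      | zero =>
        refine hT₁' _ ?_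
        simpa [Finsupp.mapDomain_of_notMem_range] using hi
      | succ i ih =>
        have h1 := ih (DFunLike.congr_fun h0 i)
        refine hT₁' _ ?_
        simpa [Finsupp.mapDomain_apply Nat.succ_injective, h1] using hi
    have : f = 0 := Finsupp.ext hf0
    rw [this, map_zero] at hf
    exact (hu.smul_eq_zero).1 hf
  have T_pow_mem : ∀ i : ℕ, ∀ x ∈ Q, τ ^ i • x ∈ Q := fun i x hx => by
    induction i with
    | zero => simpa using hx
    | succ i ih =>
      rw [pow_succ', mul_smul]
      exact hTQ _ ih
  have horner : ∀ (N : ℕ) (q : ℕ → X₀) (a : X₀),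
      (a : P) + τ • ∑ i ∈ Finset.range N, τ ^ i • (q i : P) = 0 →
      (1 : B) ⊗ₜ[R] a + τ • ∑ i ∈ Finset.range N, (τ ^ i) ⊗ₜ[R] (q i) ∈ LinearMap.range φ := by
    intro N
    induction N with
    | zero =>
      intro q a h
      have : a = 0 := by simpa using h
      simp [this]
    | succ N ih =>
      intro q a h
      set x : P := ∑ i ∈ Finset.range (N + 1), τ ^ i • (q i : P) with hx
      have hxQ : x ∈ Q :=
        Q.sum_mem fun i _ => T_pow_mem i _ (h₀Q (q i).2)
      have hx₁ : x ∈ X₁ := hT₀ x hxQ (by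
        rw [T_apply, ← neg_eq_of_add_eq_zero_right h]
        exact X₀.neg_mem a.2)
      have ha : a = -T₁ ⟨x, hx₁⟩ := Subtype.ext (eq_neg_of_add_eq_zero_left h)
      have := ih (fun i => q (i + 1)) (q 0 - ⟨x, h₁₀ hx₁⟩) (by
        rw [Finset.sum_range_succ'] at hx
        simp only [AddSubgroupClass.coe_sub, Finset.smul_sum, smul_smul, ← pow_succ']
        rw [hx]
        simp only [pow_zero, one_smul]
        abel)
      have h2 := add_mem (Submodule.smul_mem _ τ this)
        (neg_mem (LinearMap.mem_range_self φ (1 ⊗ₜ ⟨x, hx₁⟩)))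
      convert h2 using 1
      have hincl : Submodule.inclusion h₁₀ ⟨x, hx₁⟩ = ⟨x, h₁₀ hx₁⟩ := rfl
      rw [φ_tmul, ha, Finset.sum_range_succ', hincl]
      simp only [Finset.smul_sum, TensorProduct.smul_tmul', smul_eq_mul, ← pow_succ',
        smul_add, TensorProduct.tmul_sub, TensorProduct.tmul_neg, smul_sub, pow_zero, mul_one]
      abel
  have hex : Function.Exact φ π := by
    intro z
    constructor
    · intro hz
      obtain ⟨h, -, hu, f, hf⟩ := exists_unit_smul_eq_evalTensor hB z
      obtain ⟨N, hN⟩ := f.support.exists_nat_subset_range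
      have e1 : evalTensor R τ X₀ f = ∑ i ∈ Finset.range N, (τ ^ i) ⊗ₜ[R] (f i) := by
        rw [evalTensor, Finsupp.lsum_apply, Finsupp.sum_of_support_subset _ hN]
        · rfl
        · simp
      have e2 : ∑ i ∈ Finset.range N, τ ^ i • (f i : P) = 0 := by
        have : π (h • z) = 0 := by rw [map_smul, hz, smul_zero]
        rw [hf, e1, map_sum] at this
        simpa [π] using this
      have := horner N f 0 (by simp [e2])
      rw [TensorProduct.tmul_zero, zero_add, ← e1, ← hf, smul_smul] at this
      exact ((LinearMap.range φ).smul_mem_iff_of_isUnit (hτ.mul hu)).1 this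
    · rintro ⟨y, rfl⟩
      have : π ∘ₗ φ = 0 := by
        ext x
        simp [φ_tmul, π, T₁, T_apply]
      exact LinearMap.congr_fun this y
  obtain ⟨σ, hσ⟩ := Module.projective_lifting_property π LinearMap.id hπ
  refine ⟨X₁, X₀, inferInstance, inferInstance, inferInstance, inferInstance,
    .of_fg h₁, .of_fg h₀, ?_⟩
  obtain ⟨e, -⟩ := (hex.splitSurjectiveEquiv hφ ⟨σ, hσ⟩)
  exact ⟨e.trans (LinearEquiv.prodComm B _ _)⟩

end Powers

/-- A finitely generated projective `A`-module descends to a subring `B` containing the entries of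
an idempotent matrix which presents it. -/
theorem exists_projective_descent {B A : Type} [CommRing B] [CommRing A] [Algebra B A]
    (hBA : Function.Injective (algebraMap B A)) {P : Type} [AddCommGroup P] [Module A P] {m : ℕ}
    (p : (Fin m → A) →ₗ[A] P) (s : P →ₗ[A] (Fin m → A)) (hps : ∀ x, p (s x) = x)
    (hE : ∀ i j, s (p (Pi.single i 1)) j ∈ (algebraMap B A).range) :
    ∃ (Q : Type) (_ : AddCommGroup Q) (_ : Module B Q), Module.Finite B Q ∧
      Module.Projective B Q ∧ Nonempty ((A ⊗[B] Q) ≃ₗ[A] P) := by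
  let _ : Module B P := Module.compHom P (algebraMap B A)
  have : IsScalarTower B A P := IsScalarTower.of_algebraMap_smul fun _ _ => rfl
  choose E hE using hE
  let u : (Fin m → B) →ₗ[B] (Fin m → B) := (Pi.basisFun B (Fin m)).constr B fun i => E i
  have hu : ∀ i, u (Pi.single i 1) = E i := fun i => by
    rw [← Pi.basisFun_apply]
    exact (Pi.basisFun B (Fin m)).constr_basis B _ i
  let ι : (Fin m → B) →ₗ[B] (Fin m → A) := (Algebra.linearMap B A).compLeft (Fin m)
  have ι_single : ∀ i, ι (Pi.single i 1) = Pi.single i 1 := fun i => by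
    ext j
    change algebraMap B A ((Pi.single i 1 : Fin m → B) j) = _
    rw [Pi.single_apply, Pi.single_apply]
    split_ifs <;> simp
  have hι : Function.Injective ι := fun v w h => funext fun j => hBA (congrFun h j)
  have hιu : ∀ v, ι (u v) = s (p (ι v)) := by
    have : ι ∘ₗ u = (s ∘ₗ p).restrictScalars B ∘ₗ ι := by
      refine (Pi.basisFun B (Fin m)).ext fun i => ?_
      rw [Pi.basisFun_apply, LinearMap.comp_apply, hu, LinearMap.comp_apply, ι_single]
      exact funext fun j => hE i j
    exact LinearMap.congr_fun this
  have huu : ∀ v, u (u v) = u v := fun v => hι (by rw [hιu, hιu, hps])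
  have hrange : ∀ v ∈ LinearMap.range u, u v = v := by
    rintro _ ⟨w, rfl⟩
    exact huu w
  refine ⟨LinearMap.range u, inferInstance, inferInstance, inferInstance,
    Module.Projective.of_split (LinearMap.range u).subtype u.rangeRestrict
      (LinearMap.ext fun v => Subtype.ext (hrange v.1 v.2)), ⟨?_⟩⟩
  let F : A ⊗[B] LinearMap.range u →ₗ[A] P :=
    (p.restrictScalars B ∘ₗ ι ∘ₗ (LinearMap.range u).subtype).liftBaseChange A
  let G : (Fin m → A) →ₗ[A] A ⊗[B] LinearMap.range u :=
    (Pi.basisFun A (Fin m)).constr A fun i => 1 ⊗ₜ u.rangeRestrict (Pi.single i 1)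
  have hG : ∀ i, G (Pi.single i 1) = 1 ⊗ₜ u.rangeRestrict (Pi.single i 1) := fun i => by
    rw [← Pi.basisFun_apply]
    exact (Pi.basisFun A (Fin m)).constr_basis A _ i
  have hGι : ∀ v, G (ι v) = 1 ⊗ₜ u.rangeRestrict v := by
    have : G.restrictScalars B ∘ₗ ι = TensorProduct.mk B A _ 1 ∘ₗ u.rangeRestrict := by
      refine (Pi.basisFun B (Fin m)).ext fun i => ?_
      rw [Pi.basisFun_apply, LinearMap.comp_apply, ι_single]
      exact hG i
    exact LinearMap.congr_fun this
  have hFG : ∀ w, F (G w) = p w := by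
    have : F ∘ₗ G = p := by
      refine (Pi.basisFun A (Fin m)).ext fun i => ?_
      rw [Pi.basisFun_apply, LinearMap.comp_apply, hG, LinearMap.liftBaseChange_one_tmul]
      change p (ι (u (Pi.single i 1))) = _
      rw [hιu, hps, ι_single]
    exact LinearMap.congr_fun this
  refine LinearEquiv.ofLinearMap F (G ∘ₗ s) ?_ ?_
  · ext x
    simp [hFG, hps]
  · ext v
    change G (s (F (1 ⊗ₜ v))) = 1 ⊗ₜ v
    have h1 : F (1 ⊗ₜ v) = p (ι v) := LinearMap.liftBaseChange_one_tmul _ _ _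
    rw [h1, ← hιu, hGι]
    congr 1
    exact Subtype.ext ((huu _).trans (hrange v.1 v.2))

/-- Base change of a decomposition of an extended module. -/
def baseChangeDecomposition {R B : Type} (C : Type) [CommRing R] [CommRing B] [CommRing C]
    [Algebra R B] [Algebra B C] [Algebra R C] [IsScalarTower R B C]
    {Q X₁ X₀ : Type} [AddCommGroup Q] [Module B Q] [AddCommGroup X₁] [Module R X₁]
    [AddCommGroup X₀] [Module R X₀] (e : (B ⊗[R] X₀) ≃ₗ[B] (Q × (B ⊗[R] X₁))) :
    (C ⊗[R] X₀) ≃ₗ[C] ((C ⊗[B] Q) × (C ⊗[R] X₁)) :=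
  (AlgebraTensorModule.cancelBaseChange R B C C X₀).symm ≪≫ₗ
    AlgebraTensorModule.congr (LinearEquiv.refl C C) e ≪≫ₗ
    TensorProduct.prodRight B C C Q (B ⊗[R] X₁) ≪≫ₗ
    LinearEquiv.prodCongr (LinearEquiv.refl C _) (AlgebraTensorModule.cancelBaseChange R B C C X₁)

/-- Specializing along a retraction `B → R` onto a local ring identifies the rank of `Q`. -/
theorem exists_finite_linearEquiv_pi_prod {R B : Type} [CommRing R] [IsLocalRing R] [CommRing B]
    [Algebra R B] [Algebra B R] [IsScalarTower R B R]
    {Q X₁ X₀ : Type} [AddCommGroup Q] [Module B Q] [Module.Finite B Q] [Module.Projective B Q]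
    [AddCommGroup X₁] [Module R X₁]
    [AddCommGroup X₀] [Module R X₀] (e : (B ⊗[R] X₀) ≃ₗ[B] (Q × (B ⊗[R] X₁))) :
    ∃ n : ℕ, Nonempty (X₀ ≃ₗ[R] ((Fin n → R) × X₁)) := by
  have : Module.Free R (R ⊗[B] Q) := Module.free_of_flat_of_isLocalRing
  exact ⟨_, ⟨(TensorProduct.lid R X₀).symm ≪≫ₗ baseChangeDecomposition R e ≪≫ₗ
    LinearEquiv.prodCongr (Module.finBasis R (R ⊗[B] Q)).equivFun (TensorProduct.lid R X₁)⟩⟩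

theorem nonempty_stable_linearEquiv {R B A P : Type} [CommRing R] [IsLocalRing R] [CommRing B]
    [CommRing A] [Algebra R A] [Algebra R B] [Algebra B A] [IsScalarTower R B A]
    (ev : B →ₐ[R] R) [AddCommGroup P] [Module A P]
    {Q X₁ X₀ : Type} [AddCommGroup Q] [Module B Q] [Module.Finite B Q] [Module.Projective B Q]
    [AddCommGroup X₁] [Module R X₁] [AddCommGroup X₀] [Module R X₀]
    (e : (B ⊗[R] X₀) ≃ₗ[B] (Q × (B ⊗[R] X₁))) (eP : (A ⊗[B] Q) ≃ₗ[A] P) :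
    ∃ n : ℕ, Nonempty ((P × (A ⊗[R] X₁)) ≃ₗ[A] ((Fin n → A) × (A ⊗[R] X₁))) := by
  let _ : Algebra B R := ev.toRingHom.toAlgebra
  have : IsScalarTower R B R := IsScalarTower.of_algebraMap_eq fun r => (ev.commutes r).symm
  obtain ⟨n, ⟨f⟩⟩ := exists_finite_linearEquiv_pi_prod e
  exact ⟨n, ⟨LinearEquiv.prodCongr eP.symm (LinearEquiv.refl A _) ≪≫ₗ
    (baseChangeDecomposition A e).symm ≪≫ₗ
    AlgebraTensorModule.congr (LinearEquiv.refl A A) f ≪≫ₗ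
    TensorProduct.prodRight R A A _ X₁ ≪≫ₗ
    LinearEquiv.prodCongr (TensorProduct.piScalarRight R A A (Fin n)) (LinearEquiv.refl A _)⟩⟩

section Polynomial

open Polynomial

/-- Denominators in `R ⊗ L`, where `L` is a localization of `S`, can be cleared by elements of
`S`. -/
theorem exists_one_tmul_mul_mem_range {k R S L : Type} [Field k] [CommRing R] [Algebra k R]
    [CommRing S] [Algebra k S] [CommRing L] [Algebra k L] [Algebra S L] [IsScalarTower k S L]
    (M : Submonoid S) [IsLocalization M L] (a : R ⊗[k] L) :
    ∃ g ∈ M, (1 ⊗ₜ algebraMap S L g) * a ∈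
      (Algebra.TensorProduct.map (AlgHom.id R R) (IsScalarTower.toAlgHom k S L)).range := by
  induction a with
  | zero => exact ⟨1, one_mem M, by simp⟩
  | tmul r l =>
    obtain ⟨⟨p, g⟩, h⟩ := IsLocalization.surj M l
    refine ⟨g, g.2, r ⊗ₜ p, ?_⟩
    change r ⊗ₜ[k] algebraMap S L p = _
    rw [Algebra.TensorProduct.tmul_mul_tmul, one_mul, ← h, mul_comm]
  | add a b ha hb =>
    obtain ⟨g, hg, hga⟩ := ha
    obtain ⟨h, hh, hhb⟩ := hb
    have key : ∀ s : S, (1 ⊗ₜ algebraMap S L s : R ⊗[k] L) ∈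
        (Algebra.TensorProduct.map (AlgHom.id R R) (IsScalarTower.toAlgHom k S L)).range :=
      fun s => ⟨1 ⊗ₜ s, rfl⟩
    refine ⟨g * h, mul_mem hg hh, ?_⟩
    have : (1 ⊗ₜ algebraMap S L (g * h) : R ⊗[k] L) * (a + b) =
        (1 ⊗ₜ algebraMap S L h) * ((1 ⊗ₜ algebraMap S L g) * a) +
          (1 ⊗ₜ algebraMap S L g) * ((1 ⊗ₜ algebraMap S L h) * b) := by
      rw [map_mul, ← one_mul (1 : R), ← Algebra.TensorProduct.tmul_mul_tmul, one_mul]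
      ring
    rw [this]
    exact add_mem (mul_mem (key h) hga) (mul_mem (key g) hhb)

theorem one_tmul_mem_adjoin_X {k R L : Type} [Field k] [CommRing R] [Algebra k R]
    [CommRing L] [Algebra k L] [Algebra k[X] L] [IsScalarTower k k[X] L] (p : k[X]) :
    (1 ⊗ₜ algebraMap k[X] L p : R ⊗[k] L) ∈
      Algebra.adjoin R {(1 ⊗ₜ algebraMap k[X] L X : R ⊗[k] L)} := by
  have h : (1 ⊗ₜ algebraMap k[X] L p : R ⊗[k] L) =
      aeval (1 ⊗ₜ algebraMap k[X] L X : R ⊗[k] L) p := by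
    have : (Algebra.TensorProduct.includeRight.comp (IsScalarTower.toAlgHom k k[X] L) :
        k[X] →ₐ[k] R ⊗[k] L) = aeval (1 ⊗ₜ algebraMap k[X] L X) := by
      ext
      simp
    exact DFunLike.congr_fun this p
  rw [h, ← Polynomial.aeval_map_algebraMap R]
  exact aeval_mem_adjoin_singleton _ _

theorem range_map_le_adjoin_X {k R L : Type} [Field k] [CommRing R] [Algebra k R]
    [CommRing L] [Algebra k L] [Algebra k[X] L] [IsScalarTower k k[X] L] :
    (Algebra.TensorProduct.map (AlgHom.id R R) (IsScalarTower.toAlgHom k k[X] L)).range ≤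
      Algebra.adjoin R {(1 ⊗ₜ algebraMap k[X] L X : R ⊗[k] L)} := by
  rintro _ ⟨a, rfl⟩
  induction a with
  | zero => simp
  | tmul r p =>
    have : (r ⊗ₜ algebraMap k[X] L p : R ⊗[k] L) = r • (1 ⊗ₜ algebraMap k[X] L p) := by
      rw [TensorProduct.smul_tmul', smul_eq_mul, mul_one]
    change (r ⊗ₜ algebraMap k[X] L p : R ⊗[k] L) ∈ _
    rw [this]
    exact Subalgebra.smul_mem _ (one_tmul_mem_adjoin_X p) r
  | add a b ha hb =>
    rw [map_add]
    exact add_mem ha hb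

/-- If `k[X] → L` is injective then the powers of `1 ⊗ X` in `R ⊗ L` have coordinate functions. -/
theorem exists_coordinates_powers_X {k R L : Type} [Field k] [CommRing R] [Algebra k R]
    [CommRing L] [Algebra k L] [Algebra k[X] L] [IsScalarTower k k[X] L]
    (hL : Function.Injective (algebraMap k[X] L)) :
    ∃ c : ℕ → (R ⊗[k] L) →ₗ[R] R, ∀ i j,
      c i ((1 ⊗ₜ algebraMap k[X] L X : R ⊗[k] L) ^ j) = if i = j then 1 else 0 := by
  obtain ⟨f, hf⟩ := (IsScalarTower.toAlgHom k k[X] L).toLinearMap.exists_leftInverse_of_injective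
    (LinearMap.ker_eq_bot.mpr hL)
  refine ⟨fun i => (AlgebraTensorModule.rid k R R).toLinearMap ∘ₗ
    (lcoeff k i ∘ₗ f).baseChange R, fun i j => ?_⟩
  have hfX : f (algebraMap k[X] L X ^ j) = X ^ j := by
    rw [← map_pow]
    exact LinearMap.congr_fun hf _
  rw [Algebra.TensorProduct.tmul_pow, one_pow]
  simp [hfX, coeff_X_pow]

theorem exists_extended_decomposition_away {k R L : Type} [Field k] [CommRing R] [Algebra k R]
    [IsNoetherianRing R] [CommRing L] [Algebra k L] [Algebra k[X] L] [IsScalarTower k k[X] L]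
    {G : k[X]} [IsLocalization.Away G L] (hG : G ≠ 0) (hX : X ∣ G)
    (P : Type) [AddCommGroup P] [Module (R ⊗[k] L) P] [Module.Finite (R ⊗[k] L) P]
    [Module.Projective (R ⊗[k] L) P] :
    ∃ (X₁ X₀ : Type) (_ : AddCommGroup X₁) (_ : Module R X₁) (_ : AddCommGroup X₀)
      (_ : Module R X₀), Module.Finite R X₁ ∧ Module.Finite R X₀ ∧
      Nonempty (((R ⊗[k] L) ⊗[R] X₀) ≃ₗ[R ⊗[k] L] (P × ((R ⊗[k] L) ⊗[R] X₁))) := by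
  have hunit : ∀ g : k[X], IsUnit (algebraMap k[X] L g) →
      IsUnit (1 ⊗ₜ algebraMap k[X] L g : R ⊗[k] L) := fun g hg =>
    hg.map (Algebra.TensorProduct.includeRight : L →ₐ[k] R ⊗[k] L)
  obtain ⟨c, hc⟩ := exists_coordinates_powers_X (k := k) (R := R) (L := L)
    (IsLocalization.injective L (powers_le_nonZeroDivisors_of_noZeroDivisors hG))
  refine exists_extended_decomposition (τ := (1 ⊗ₜ algebraMap k[X] L X : R ⊗[k] L))
    (hunit X (isUnit_of_dvd_unit (map_dvd _ hX) (IsLocalization.Away.algebraMap_isUnit G)))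
    c hc (fun b => ?_) P
  obtain ⟨g, hg, hgb⟩ := exists_one_tmul_mul_mem_range (Submonoid.powers G) b
  exact ⟨_, one_tmul_mem_adjoin_X g, hunit g (IsLocalization.map_units L ⟨g, hg⟩),
    range_map_le_adjoin_X hgb⟩

/-- Over an infinite field, `R ⊗ k[X]_G` has an `R`-point. -/
theorem nonempty_algHom_tensor_away {k R L : Type} [Field k] [Infinite k] [CommRing R]
    [Algebra k R] [CommRing L] [Algebra k L] [Algebra k[X] L] [IsScalarTower k k[X] L]
    {G : k[X]} [IsLocalization.Away G L] (hG : G ≠ 0) : Nonempty ((R ⊗[k] L) →ₐ[R] R) := by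
  obtain ⟨c, hc⟩ : ∃ c, G.eval c ≠ 0 := by
    by_contra! h
    exact hG (Polynomial.funext fun c => by simp [h])
  let e : L →ₐ[k] k := IsLocalization.liftAlgHom (M := Submonoid.powers G) (f := aeval c) (by
    rintro ⟨_, n, rfl⟩
    simpa using fun h => absurd h hc)
  exact ⟨Algebra.TensorProduct.lift (AlgHom.id R R) ((Algebra.ofId k R).comp e)
    fun _ _ => Commute.all _ _⟩

theorem exists_stable_linearEquiv_base_change {k R K : Type} [Field k] [Infinite k] [CommRing R]
    [Algebra k R] [IsLocalRing R] [IsNoetherianRing R] [Field K] [Algebra k K] [Algebra k[X] K]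
    [IsScalarTower k k[X] K] [IsFractionRing k[X] K] (P : Type) [AddCommGroup P]
    [Module (R ⊗[k] K) P] [Module.Finite (R ⊗[k] K) P] [Module.Projective (R ⊗[k] K) P] :
    ∃ (n : ℕ) (X₁ : Type) (_ : AddCommGroup X₁) (_ : Module R X₁), Module.Finite R X₁ ∧
      Nonempty ((P × ((R ⊗[k] K) ⊗[R] X₁)) ≃ₗ[R ⊗[k] K]
        ((Fin n → R ⊗[k] K) × ((R ⊗[k] K) ⊗[R] X₁))) := by
  obtain ⟨m, p, hp⟩ := Module.Finite.exists_fin' (R ⊗[k] K) P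
  obtain ⟨s, hs⟩ := Module.projective_lifting_property p LinearMap.id hp
  choose g hg hgs using fun i j => exists_one_tmul_mul_mem_range (nonZeroDivisors k[X])
    (s (p (Pi.single i 1)) j)
  let G : k[X] := X * ∏ i, ∏ j, g i j
  have hG : G ≠ 0 := mul_ne_zero X_ne_zero (Finset.prod_ne_zero_iff.mpr fun i _ =>
    Finset.prod_ne_zero_iff.mpr fun j _ => nonZeroDivisors.ne_zero (hg i j))
  let L := Localization.Away G
  have hGK : ∀ y : Submonoid.powers G, IsUnit (IsScalarTower.toAlgHom k k[X] K (y : k[X])) :=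
    fun y =>
    IsLocalization.map_units (M := nonZeroDivisors k[X]) K
      ⟨y.1, powers_le_nonZeroDivisors_of_noZeroDivisors hG y.2⟩
  let φ : L →ₐ[k] K := IsLocalization.liftAlgHom hGK
  have hφ : ∀ q, φ (algebraMap k[X] L q) = algebraMap k[X] K q := fun q =>
    IsLocalization.lift_eq _ q
  have hφ_inj : Function.Injective φ := (IsLocalization.lift_injective_iff _).mpr fun x y => by
    rw [(IsLocalization.injective L (powers_le_nonZeroDivisors_of_noZeroDivisors hG)).eq_iff]
    exact (IsFractionRing.injective k[X] K).eq_iff.symm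
  let Φ : (R ⊗[k] L) →ₐ[R] (R ⊗[k] K) := Algebra.TensorProduct.map (AlgHom.id R R) φ
  let _ : Algebra (R ⊗[k] L) (R ⊗[k] K) := Φ.toRingHom.toAlgebra
  have : IsScalarTower R (R ⊗[k] L) (R ⊗[k] K) :=
    IsScalarTower.of_algebraMap_eq fun r => (Φ.commutes r).symm
  have hΦ : Function.Injective (algebraMap (R ⊗[k] L) (R ⊗[k] K)) :=
    Module.Flat.lTensor_preserves_injective_linearMap (M := R) φ.toLinearMap hφ_inj
  have hE : ∀ i j, s (p (Pi.single i 1)) j ∈ (algebraMap (R ⊗[k] L) (R ⊗[k] K)).range := by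
    intro i j
    obtain ⟨b, hb⟩ := hgs i j
    have hdvd : g i j ∣ G := ((Finset.dvd_prod_of_mem (g i) (Finset.mem_univ j)).trans
      (Finset.dvd_prod_of_mem (fun i => ∏ j, g i j) (Finset.mem_univ i))).trans
        (dvd_mul_left _ _)
    obtain ⟨w, hw⟩ := isUnit_iff_exists_inv.mp (isUnit_of_dvd_unit
      (map_dvd (algebraMap k[X] L) hdvd) (IsLocalization.Away.algebraMap_isUnit G))
    have hw' : (1 ⊗ₜ φ w : R ⊗[k] K) * (1 ⊗ₜ algebraMap k[X] K (g i j)) = 1 := by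
      rw [Algebra.TensorProduct.tmul_mul_tmul, ← hφ, ← map_mul, mul_comm w, hw, map_one, one_mul]
      rfl
    refine ⟨(1 ⊗ₜ w) *
      Algebra.TensorProduct.map (AlgHom.id R R) (IsScalarTower.toAlgHom k k[X] L) b, ?_⟩
    have h1 : ∀ b, Φ (Algebra.TensorProduct.map (AlgHom.id R R)
        (IsScalarTower.toAlgHom k k[X] L) b) =
        Algebra.TensorProduct.map (AlgHom.id R R) (IsScalarTower.toAlgHom k k[X] K) b := by
      intro b
      induction b with
      | zero => simp
      | tmul r q => exact congrArg (r ⊗ₜ[k] ·) (hφ q)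
      | add a b ha hb => rw [map_add, map_add, map_add, ha, hb]
    change Φ _ = _
    rw [map_mul, h1]
    refine (congrArg (Φ (1 ⊗ₜ w) * ·) hb).trans ?_
    change (1 ⊗ₜ φ w : R ⊗[k] K) * _ = _
    rw [← mul_assoc, hw', one_mul]
  obtain ⟨Q, _, _, _, _, ⟨eP⟩⟩ := exists_projective_descent hΦ p s (LinearMap.congr_fun hs) hE
  obtain ⟨X₁, X₀, _, _, _, _, _, _, ⟨e⟩⟩ :=
    exists_extended_decomposition_away (R := R) (L := L) hG (dvd_mul_right X _) Q
  obtain ⟨ev⟩ := nonempty_algHom_tensor_away (R := R) (L := L) hG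
  obtain ⟨n, h⟩ := nonempty_stable_linearEquiv ev e eP
  exact ⟨n, X₁, inferInstance, inferInstance, inferInstance, h⟩

end Polynomial

/-- **Yoshino, Proposition 7.3.**  Let `k` be an infinite field, `(R, 𝔪, k)` a Gorenstein
local `k`-algebra and `K = k(t)`.  Given a finitely generated projective `R ⊗_k K`-module
`P`, there are a Cohen–Macaulay `R`-module `X` and `n ∈ ℕ` with
`P ⊕ (X ⊗_k K) ≅ (R^n ⊗_k K) ⊕ (X ⊗_k K)` as `R ⊗_k K`-modules; here `X ⊗_k K` is the
base change `(R ⊗_k K) ⊗_R X` and `R^n ⊗_k K` is the free module `(R ⊗_k K)^n`. -/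
theorem projective_stably_extended_from_CM
    (k : Type) [Field k] [Infinite k]
    (R : Type) [CommRing R] [Algebra k R] [IsLocalRing R]
    (hGor : IsGorensteinLocalRing R)
    (hres : Function.Bijective (algebraMap k (R ⧸ IsLocalRing.maximalIdeal R)))
    (P : Type) [AddCommGroup P] [Module (AK k R) P]
    (hfg : Module.Finite (AK k R) P) (hproj : Module.Projective (AK k R) P) :
    ∃ (X : Type) (_ : AddCommGroup X) (_ : Module R X), IsCMModule R X ∧
      ∃ n : ℕ,
        Nonempty ((P × (AK k R ⊗[R] X)) ≃ₗ[AK k R]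
          ((Fin n → AK k R) × (AK k R ⊗[R] X))) := by
  have := hGor.1
  have : Module.Flat R (AK k R) := inferInstanceAs (Module.Flat R (R ⊗[k] RatFunc k))
  obtain ⟨n, X₁, _, _, _, ⟨e⟩⟩ : ∃ (n : ℕ) (X₁ : Type) (_ : AddCommGroup X₁) (_ : Module R X₁),
      Module.Finite R X₁ ∧ Nonempty ((P × (AK k R ⊗[R] X₁)) ≃ₗ[AK k R]
        ((Fin n → AK k R) × (AK k R ⊗[R] X₁))) := by
    let _ : Module (R ⊗[k] RatFunc k) P := inferInstanceAs (Module (AK k R) P)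
    have : Module.Finite (R ⊗[k] RatFunc k) P := hfg
    have : Module.Projective (R ⊗[k] RatFunc k) P := hproj
    exact exists_stable_linearEquiv_base_change (k := k) (R := R) (K := RatFunc k) P
  obtain ⟨Y, _, _, hY, f⟩ := exists_isCMModule_of_finite (A := AK k R) hGor e
  exact ⟨Y, inferInstance, inferInstance, hY, n, f⟩

end
end
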